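/- There exists an absolute constant C > 0 such that for every reduced rational α = v/w ∈ (0,1] and every real U ≥ 2, the count R_{3,α}(U) of quadruples (p,q,n,k) ∈ ℕ⁴ satisfying gcd(p,q) = 1, 1 ≤ q < p ≤ U, 2 ≤ nq + kp ≤ U², 1 ≤ k < n, and inv_p(q) ≤ α·p, obeys | R_{3,α}(U)/U⁴ − α(log U)²/(4ζ(2)) − (α log U/(2ζ(2)))·(γ − ζ′(2)/ζ(2) + F(α) − log 2) | ≤ C·(1 + log w)², where γ is the Euler–Mascheroni constant. -/

import Mathlib

/-- `inv_p(q)`: the least positive integer in the residue class `q⁻¹ (mod p)`. -/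
def modInv (p q : ℕ) : ℕ := if ((q : ZMod p)⁻¹).val = 0 then p else ((q : ZMod p)⁻¹).val
/-- The Hurwitz zeta value `ζ(2,x) = ∑_{n ≥ 0} (n+x)^{-2}`. -/
noncomputable def hzeta2 (x : ℝ) : ℝ := ∑' n : ℕ, 1 / ((n : ℝ) + x) ^ 2

/-- The quantity `F(α) = (1/(α w²)) ∑_{1 ≤ r < w} (1 - {α r}) ζ(2, r/w)` for a reduced
rational `α = v/w`. -/
noncomputable def Fcal (α : ℚ) : ℝ :=
  (1 / ((α : ℝ) * (α.den : ℝ) ^ 2)) *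
    ∑ r ∈ Finset.Ico 1 α.den, (1 - Int.fract ((α : ℝ) * r)) * hzeta2 ((r : ℝ) / (α.den : ℝ))
/-- `ζ'(2)`, the derivative of the Riemann zeta function at `2` (a real number). -/
noncomputable def zetaDeriv2 : ℝ := (deriv riemannZeta 2).re

/-- The system of Case 3: `gcd(p,q) = 1`, `1 ≤ q < p ≤ U`, `2 ≤ nq + kp ≤ U²`,
`1 ≤ k < n`, `inv_p(q) ≤ α·p`. -/
def Case3 (α : ℚ) (U : ℝ) (p q n k : ℕ) : Prop :=
  Nat.gcd p q = 1 ∧ 1 ≤ q ∧ q < p ∧ (p : ℝ) ≤ U ∧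
  2 ≤ n * q + k * p ∧ ((n * q + k * p : ℕ) : ℝ) ≤ U ^ 2 ∧
  1 ≤ k ∧ k < n ∧ (modInv p q : ℝ) ≤ (α : ℝ) * p


section
open Set Filter Topology

noncomputable section

/-- Gauss branch probabilities. -/
def gP (m : ℕ) (x : ℝ) : ℝ := (1 + x) / (((m : ℝ) + 1 + x) * ((m : ℝ) + 2 + x))

/-- The Gauss transfer operator. -/
def gU (f : ℝ → ℝ) (x : ℝ) : ℝ := ∑' m : ℕ, gP m x * f (1 / ((m : ℝ) + 1 + x))

/-- Antitone functions with zero Gauss mean and small oscillation. -/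
structure GClass (f : ℝ → ℝ) (δ : ℝ) : Prop where
  cont : ContinuousOn f (Icc 0 1)
  anti : AntitoneOn f (Icc 0 1)
  mean : ∫ x in (0:ℝ)..1, f x / (1 + x) = 0
  osc : f 0 - f 1 ≤ δ

lemma gP_nonneg (m : ℕ) {x : ℝ} (hx : x ∈ Icc (0:ℝ) 1) : 0 ≤ gP m x := by
  have := hx.1
  unfold gP; positivity

lemma gP_le (m : ℕ) {x : ℝ} (hx : x ∈ Icc (0:ℝ) 1) :
    gP m x ≤ 2 / (((m : ℝ) + 1) * ((m : ℝ) + 2)) := by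
  have h0 := hx.1
  have h1 := hx.2
  unfold gP
  apply div_le_div₀ (by norm_num) (by linarith) (by positivity)
  apply mul_le_mul <;> first | linarith | positivity

lemma hasSum_telescope (W : ℕ → ℝ) (hW : Tendsto W atTop (𝓝 0)) (hm : ∀ m, W (m+1) ≤ W m) :
    HasSum (fun m => W m - W (m+1)) (W 0) := by
  rw [hasSum_iff_tendsto_nat_of_nonneg (fun i => by linarith [hm i])]
  have : (fun n => ∑ i ∈ Finset.range n, (W i - W (i+1))) = fun n => W 0 - W n := by
    funext n; exact Finset.sum_range_sub' W n
  rw [this]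
  simpa using (tendsto_const_nhds (x := W 0)).sub hW

lemma hasSum_gP {x : ℝ} (hx : x ∈ Icc (0:ℝ) 1) : HasSum (fun m => gP m x) 1 := by
  have h0 := hx.1
  have h := hasSum_telescope (fun m : ℕ => (1 + x) / ((m : ℝ) + 1 + x)) ?_ ?_
  · convert h using 1
    · funext m
      unfold gP
      push_cast
      have : (m : ℝ) + 1 + x > 0 := by positivity
      have : (m : ℝ) + 2 + x > 0 := by positivity
      have : (m : ℝ) + 1 + 1 + x > 0 := by positivity
      field_simp
      ring
    · simp
      field_simp
  · apply Tendsto.const_div_atTop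
    have : Tendsto (fun m : ℕ => (m : ℝ) + (1 + x)) atTop atTop :=
      tendsto_atTop_add_const_right _ _ tendsto_natCast_atTop_atTop
    simpa [add_assoc] using this
  · intro m
    push_cast
    gcongr
    linarith

lemma arg_mem (m : ℕ) {x : ℝ} (hx : x ∈ Icc (0:ℝ) 1) : 1 / ((m : ℝ) + 1 + x) ∈ Icc (0:ℝ) 1 := by
  have h0 := hx.1
  have hm : (0:ℝ) ≤ m := Nat.cast_nonneg m
  constructor
  · positivity
  · rw [div_le_one (by positivity)]; linarith

lemma summable_bd : Summable (fun m : ℕ => 2 / (((m : ℝ) + 1) * ((m : ℝ) + 2))) := by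
  have := (hasSum_gP (x := 0) (by simp)).summable.mul_left 2
  refine this.congr (fun m => ?_)
  simp [gP]; field_simp

lemma GClass.abs_le {f : ℝ → ℝ} {δ : ℝ} (h : GClass f δ) {x : ℝ} (hx : x ∈ Icc (0:ℝ) 1) :
    |f x| ≤ δ := by
  have h01 : (0:ℝ) ∈ Icc (0:ℝ) 1 := by simp
  have h11 : (1:ℝ) ∈ Icc (0:ℝ) 1 := by simp
  have a1 := h.anti h01 hx hx.1
  have a2 := h.anti hx h11 hx.2
  have hi : IntervalIntegrable (fun x => f x / (1 + x)) MeasureTheory.volume 0 1 := by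
    apply ContinuousOn.intervalIntegrable
    rw [uIcc_of_le zero_le_one]
    refine h.cont.div (by fun_prop) (fun y hy => ?_)
    have := hy.1; positivity
  have hc : ∀ c : ℝ, IntervalIntegrable (fun x => c / (1 + x)) MeasureTheory.volume 0 1 := by
    intro c
    apply ContinuousOn.intervalIntegrable
    rw [uIcc_of_le zero_le_one]
    refine continuousOn_const.div (by fun_prop) (fun y hy => ?_)
    have := hy.1; positivity
  have hv : ∀ c : ℝ, ∫ x in (0:ℝ)..1, c / (1 + x) = c * Real.log 2 := by
    intro c
    have := intervalIntegral.integral_comp_add_left (a := 0) (b := 1) (fun x : ℝ => c / x) 1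
    rw [this]
    simp only [div_eq_mul_inv]
    rw [intervalIntegral.integral_const_mul, integral_inv_of_pos (by norm_num) (by norm_num)]
    norm_num
  have hl : 0 < Real.log 2 := Real.log_pos (by norm_num)
  have b1 : 0 ≤ f 0 := by
    have := intervalIntegral.integral_mono_on zero_le_one hi (hc (f 0)) (fun y hy => by
      have h0 := hy.1
      have := h.anti h01 hy hy.1
      gcongr)
    rw [h.mean, hv] at this
    by_contra hneg
    push Not at hneg
    nlinarith
  have b2 : f 1 ≤ 0 := by
    have := intervalIntegral.integral_mono_on zero_le_one (hc (f 1)) hi (fun y hy => by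
      have h0 := hy.1
      have := h.anti hy h11 hy.2
      gcongr)
    rw [h.mean, hv] at this
    by_contra hneg
    push Not at hneg
    nlinarith
  have := h.osc
  rw [_root_.abs_le]; constructor <;> linarith

lemma hasSum_integral01 (F : ℕ → ℝ → ℝ) (u : ℕ → ℝ) (hu : Summable u)
    (hc : ∀ m, ContinuousOn (F m) (Icc 0 1)) (hb : ∀ m, ∀ x ∈ Icc (0:ℝ) 1, |F m x| ≤ u m) :
    HasSum (fun m => ∫ x in (0:ℝ)..1, F m x) (∫ x in (0:ℝ)..1, ∑' m, F m x) := by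
  have hsub : uIoc (0:ℝ) 1 ⊆ Icc 0 1 := by
    rw [uIoc_of_le zero_le_one]; exact Ioc_subset_Icc_self
  apply intervalIntegral.hasSum_integral_of_dominated_convergence (fun m _ => u m)
  · intro m
    exact ((hc m).mono hsub).aestronglyMeasurable measurableSet_uIoc
  · intro m
    exact Eventually.of_forall (fun t ht => hb m t (hsub ht))
  · exact Eventually.of_forall (fun t ht => hu)
  · simp
  · refine Eventually.of_forall (fun t ht => ?_)
    exact (Summable.of_norm_bounded hu (fun m => hb m t (hsub ht))).hasSum

lemma gU_summable {f : ℝ → ℝ} {M : ℝ} (hM : ∀ x ∈ Icc (0:ℝ) 1, |f x| ≤ M) {x : ℝ}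
    (hx : x ∈ Icc (0:ℝ) 1) : Summable (fun m : ℕ => gP m x * f (1 / ((m : ℝ) + 1 + x))) := by
  refine Summable.of_norm_bounded ((hasSum_gP hx).summable.mul_right M) (fun m => ?_)
  rw [Real.norm_eq_abs, abs_mul, abs_of_nonneg (gP_nonneg m hx)]
  exact mul_le_mul_of_nonneg_left (hM _ (arg_mem m hx)) (gP_nonneg m hx)

lemma gU_bound {f : ℝ → ℝ} {M : ℝ} (hM : ∀ x ∈ Icc (0:ℝ) 1, |f x| ≤ M) {x : ℝ}
    (hx : x ∈ Icc (0:ℝ) 1) : |gU f x| ≤ M := by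
  unfold gU
  have h1 : HasSum (fun m => gP m x * M) M := by simpa using (hasSum_gP hx).mul_right M
  rw [← Real.norm_eq_abs]
  refine tsum_of_norm_bounded h1 (fun m => ?_)
  rw [Real.norm_eq_abs, abs_mul, abs_of_nonneg (gP_nonneg m hx)]
  exact mul_le_mul_of_nonneg_left (hM _ (arg_mem m hx)) (gP_nonneg m hx)

lemma gterm_cont {f : ℝ → ℝ} (hf : ContinuousOn f (Icc 0 1)) (m : ℕ) :
    ContinuousOn (fun x => gP m x * f (1 / ((m : ℝ) + 1 + x))) (Icc 0 1) := by
  apply ContinuousOn.mul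
  · unfold gP
    refine ContinuousOn.div (by fun_prop) (by fun_prop) (fun x hx => ?_)
    have := hx.1; positivity
  · refine hf.comp ?_ (fun x hx => arg_mem m hx)
    refine ContinuousOn.div (by fun_prop) (by fun_prop) (fun x hx => ?_)
    have := hx.1; positivity

lemma gU_cont {f : ℝ → ℝ} {M : ℝ} (hf : ContinuousOn f (Icc 0 1))
    (hM : ∀ x ∈ Icc (0:ℝ) 1, |f x| ≤ M) : ContinuousOn (gU f) (Icc 0 1) := by
  unfold gU
  refine continuousOn_tsum (gterm_cont hf) (summable_bd.mul_right M) (fun m x hx => ?_)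
  rw [Real.norm_eq_abs, abs_mul, abs_of_nonneg (gP_nonneg m hx)]
  exact mul_le_mul (gP_le m hx) (hM _ (arg_mem m hx)) (abs_nonneg _) (by positivity)

lemma gU_mono {f : ℝ → ℝ} {M : ℝ} (hf : AntitoneOn f (Icc 0 1))
    (hM : ∀ x ∈ Icc (0:ℝ) 1, |f x| ≤ M) : MonotoneOn (gU f) (Icc 0 1) := by
  intro x hx y hy hxy
  have hx0 := hx.1
  have hy0 := hy.1
  have hx1 := hx.2
  have hy1 := hy.2
  have sx := gU_summable hM hx
  have sy := gU_summable hM hy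
  have px := (hasSum_gP hx).mul_right (f (1 / (((1:ℕ) : ℝ) + 1 + y)))
  have py := (hasSum_gP hy).mul_right (f (1 / (((1:ℕ) : ℝ) + 1 + y)))
  have hx' := sx.hasSum.sub px
  have hy' := sy.hasSum.sub py
  have := hasSum_le (fun m => ?_) hx' hy'
  · unfold gU; linarith
  · set A := f (1 / ((m : ℝ) + 1 + x)) with hA
    set B := f (1 / ((m : ℝ) + 1 + y)) with hB
    set c := f (1 / (((1:ℕ) : ℝ) + 1 + y)) with hc
    have hAB : A ≤ B := by
      apply hf (arg_mem m hy) (arg_mem m hx)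
      gcongr
    have hPd : gP m y - gP m x = (y - x) * ((m:ℝ) * (m + 1) - (1 + x) * (1 + y)) /
        ((((m : ℝ) + 1 + x) * ((m : ℝ) + 2 + x)) * (((m : ℝ) + 1 + y) * ((m : ℝ) + 2 + y))) := by
      unfold gP
      have : (m : ℝ) + 1 + x > 0 := by positivity
      have : (m : ℝ) + 2 + x > 0 := by positivity
      have : (m : ℝ) + 1 + y > 0 := by positivity
      have : (m : ℝ) + 2 + y > 0 := by positivity
      field_simp
      ring
    have key : 0 ≤ (gP m y - gP m x) * (B - c) := by
      rcases m with _ | _ | m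
      · apply mul_nonneg_of_nonpos_of_nonpos
        · rw [hPd]
          apply div_nonpos_of_nonpos_of_nonneg
          · apply mul_nonpos_of_nonneg_of_nonpos (by linarith)
            push_cast; nlinarith
          · positivity
        · have : B ≤ c := hf (arg_mem 1 hy) (arg_mem 0 hy) (by push_cast; gcongr; norm_num)
          linarith
      · simp [hB, hc]
      · apply mul_nonneg
        · rw [hPd]
          apply div_nonneg
          · apply mul_nonneg (by linarith)
            push_cast
            have : (0:ℝ) ≤ m := Nat.cast_nonneg m
            have : (1 + x) * (1 + y) ≤ 2 * 2 := by gcongr <;> linarith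
            nlinarith
          · positivity
        · have : c ≤ B := hf (arg_mem _ hy) (arg_mem 1 hy) (by
            push_cast
            have : (0:ℝ) ≤ m := Nat.cast_nonneg m
            apply one_div_le_one_div_of_le <;> linarith)
          linarith
    have := mul_le_mul_of_nonneg_left hAB (gP_nonneg m hx)
    nlinarith

lemma gU_osc {f : ℝ → ℝ} {M : ℝ} (hf : AntitoneOn f (Icc 0 1))
    (hM : ∀ x ∈ Icc (0:ℝ) 1, |f x| ≤ M) : gU f 1 - gU f 0 ≤ (f 0 - f 1) / 2 := by
  have h01 : (0:ℝ) ∈ Icc (0:ℝ) 1 := by simp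
  have h11 : (1:ℝ) ∈ Icc (0:ℝ) 1 := by simp
  have s0 := gU_summable hM h01
  have e0 : gU f 0 = 1 / 2 * f 1 + ∑' m : ℕ, gP (m+1) 0 * f (1 / ((m : ℝ) + 2)) := by
    unfold gU
    rw [s0.tsum_eq_zero_add]
    congr 1
    · norm_num [gP]
    · apply tsum_congr; intro m; push_cast; congr 3; ring
  have e1 : gU f 1 = 2 * ∑' m : ℕ, gP (m+1) 0 * f (1 / ((m : ℝ) + 2)) := by
    unfold gU
    rw [← tsum_mul_left]
    apply tsum_congr; intro m
    rw [← mul_assoc]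
    congr 2
    · unfold gP; push_cast
      have : (m : ℝ) + 1 + 1 > 0 := by positivity
      field_simp
      ring
    · congr 1; ring
  have p0 : HasSum (fun m => gP (m+1) 0) (1/2) := by
    have := (hasSum_nat_add_iff' 1).mpr (hasSum_gP h01)
    have e : (1:ℝ) - ∑ i ∈ Finset.range 1, gP i 0 = 1 / 2 := by norm_num [gP]
    rwa [e] at this
  have s1 : Summable (fun m : ℕ => gP (m+1) 0 * f (1 / ((m : ℝ) + 2))) := by
    refine ((summable_nat_add_iff 1).mpr s0).congr (fun m => ?_)
    push_cast; congr 3; ring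
  have := hasSum_le (fun m => ?_) s1.hasSum (p0.mul_right (f 0))
  · rw [e0, e1]; linarith
  · apply mul_le_mul_of_nonneg_left _ (gP_nonneg _ h01)
    apply hf h01
    · have := arg_mem (m+1) h01
      push_cast at this
      convert this using 2; ring
    · positivity

lemma gU_mean {f : ℝ → ℝ} {M : ℝ} (hf : ContinuousOn f (Icc 0 1))
    (hM : ∀ x ∈ Icc (0:ℝ) 1, |f x| ≤ M) :
    ∫ x in (0:ℝ)..1, gU f x / (1 + x) = ∫ x in (0:ℝ)..1, f x / (1 + x) := by
  have hg : ContinuousOn (fun x => f x / (1 + x)) (Icc 0 1) := by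
    refine hf.div (by fun_prop) (fun y hy => ?_)
    have := hy.1; positivity
  have hM0 : 0 ≤ M := (abs_nonneg _).trans (hM 0 (by simp))
  have h1 := hasSum_integral01 (fun m x => gP m x * f (1 / ((m : ℝ) + 1 + x)) / (1 + x))
    (fun m => 2 / (((m : ℝ) + 1) * ((m : ℝ) + 2)) * M) (summable_bd.mul_right M)
    (fun m => ?_) (fun m x hx => ?_)
  rotate_left
  · refine (gterm_cont hf m).div (by fun_prop) (fun y hy => ?_)
    have := hy.1; positivity
  · have h0 := hx.1
    rw [abs_div, abs_mul, abs_of_nonneg (gP_nonneg m hx), abs_of_pos (by positivity : 0 < 1 + x)]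
    calc _ ≤ gP m x * |f (1 / ((m : ℝ) + 1 + x))| := by
            apply div_le_self (mul_nonneg (gP_nonneg m hx) (abs_nonneg _)); linarith
      _ ≤ _ := mul_le_mul (gP_le m hx) (hM _ (arg_mem m hx)) (abs_nonneg _) (by positivity)
  have e1 : (∫ x in (0:ℝ)..1, ∑' m : ℕ, gP m x * f (1 / ((m : ℝ) + 1 + x)) / (1 + x))
      = ∫ x in (0:ℝ)..1, gU f x / (1 + x) := by
    congr 1; funext x; unfold gU; rw [tsum_div_const]
  rw [e1] at h1
  set G : ℕ → ℝ := fun m => ∫ x in (0:ℝ)..(1 / ((m:ℝ) + 1)), f x / (1 + x) with hG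
  have hint : ∀ a b : ℝ, a ∈ Icc (0:ℝ) 1 → b ∈ Icc (0:ℝ) 1 →
      IntervalIntegrable (fun x => f x / (1 + x)) MeasureTheory.volume a b := by
    intro a b ha hb
    exact (hg.mono (by apply uIcc_subset_Icc ha hb)).intervalIntegrable
  have e2 : ∀ m : ℕ, ∫ x in (0:ℝ)..1, gP m x * f (1 / ((m : ℝ) + 1 + x)) / (1 + x)
      = G m - G (m+1) := by
    intro m
    have hm1 : 1 / ((m:ℝ) + 1) ∈ Icc (0:ℝ) 1 := by simpa using arg_mem m (x := 0) (by simp)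
    have hm2 : 1 / (((m+1:ℕ):ℝ) + 1) ∈ Icc (0:ℝ) 1 := by
      simpa using arg_mem (m+1) (x := 0) (by simp)
    rw [hG]
    simp only
    rw [intervalIntegral.integral_interval_sub_left (hint _ _ (by simp) hm1)
      (hint _ _ (by simp) hm2),
      intervalIntegral.integral_symm (1 / ((m:ℝ) + 1))]
    have := intervalIntegral.integral_comp_mul_deriv'' (a := 0) (b := 1)
      (f := fun x : ℝ => 1 / ((m:ℝ) + 1 + x)) (f' := fun x : ℝ => - (1 / ((m:ℝ) + 1 + x)^2))
      (g := fun x => f x / (1 + x)) ?_ ?_ ?_ ?_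
    · simp only [add_zero] at this
      have e3 : 1 / (((m+1:ℕ):ℝ) + 1) = 1 / ((m:ℝ) + 1 + 1) := by push_cast; rfl
      rw [e3, ← this, ← intervalIntegral.integral_neg]
      apply intervalIntegral.integral_congr
      intro x hx
      rw [uIcc_of_le zero_le_one] at hx
      have h0 := hx.1
      simp only [Function.comp, gP]
      have : (m : ℝ) + 1 + x > 0 := by positivity
      have : (m : ℝ) + 2 + x > 0 := by positivity
      have : (1 : ℝ) + x > 0 := by positivity
      have : 1 + 1 / ((m : ℝ) + 1 + x) = ((m : ℝ) + 2 + x) / ((m : ℝ) + 1 + x) := by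
        field_simp; ring
      rw [this]
      field_simp
    · rw [uIcc_of_le zero_le_one]
      refine ContinuousOn.div (by fun_prop) (by fun_prop) (fun x hx => ?_)
      have := hx.1; positivity
    · intro x hx
      rw [min_eq_left zero_le_one, max_eq_right zero_le_one] at hx
      have h0 := hx.1
      have hpos : (m : ℝ) + 1 + x > 0 := by positivity
      apply HasDerivAt.hasDerivWithinAt
      have := ((hasDerivAt_id x).const_add ((m:ℝ)+1)).inv hpos.ne'
      have e : (fun x : ℝ => 1 / ((m:ℝ) + 1 + x)) = (fun x : ℝ => (m:ℝ) + 1 + id x)⁻¹ := by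
        funext y; simp
      rw [e, ← neg_div]
      exact this
    · rw [uIcc_of_le zero_le_one]
      apply ContinuousOn.neg
      refine ContinuousOn.div (by fun_prop) (by fun_prop) (fun x hx => ?_)
      have := hx.1; positivity
    · rw [uIcc_of_le zero_le_one]
      apply hg.mono
      rintro _ ⟨x, hx, rfl⟩
      exact arg_mem m hx
  simp_rw [e2] at h1
  have h2 : Tendsto G atTop (𝓝 0) := by
    have hb : ∀ m : ℕ, ‖G m‖ ≤ M * (1 / ((m:ℝ) + 1)) := by
      intro m
      have := intervalIntegral.norm_integral_le_of_norm_le_const (a := 0) (b := 1 / ((m:ℝ)+1))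
        (f := fun x => f x / (1 + x)) (C := M) ?_
      · rw [sub_zero, abs_of_pos (by positivity)] at this
        exact this
      · intro x hx
        rw [uIoc_of_le (by positivity)] at hx
        have h0 := hx.1
        have hm1 : 1 / ((m:ℝ) + 1) ∈ Icc (0:ℝ) 1 := by simpa using arg_mem m (x := 0) (by simp)
        have : x ∈ Icc (0:ℝ) 1 := ⟨h0.le, hx.2.trans hm1.2⟩
        rw [Real.norm_eq_abs, abs_div, abs_of_pos (by positivity : 0 < 1 + x)]
        exact (div_le_self (abs_nonneg _) (by linarith)).trans (hM x this)
    apply squeeze_zero_norm hb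
    simpa using (tendsto_one_div_add_atTop_nhds_zero_nat (𝕜 := ℝ)).const_mul M
  have h3 : Tendsto (fun n => ∑ i ∈ Finset.range n, (G i - G (i+1))) atTop (𝓝 (G 0)) := by
    have : (fun n => ∑ i ∈ Finset.range n, (G i - G (i+1))) = fun n => G 0 - G n := by
      funext n; exact Finset.sum_range_sub' G n
    rw [this]
    simpa using (tendsto_const_nhds (x := G 0)).sub h2
  have h4 := tendsto_nhds_unique h1.tendsto_sum_nat h3
  rw [h4, hG]; simp

lemma GClass.step {f : ℝ → ℝ} {δ : ℝ} (h : GClass f δ) :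
    GClass (fun x => - gU f x) (δ / 2) := by
  have hM : ∀ x ∈ Icc (0:ℝ) 1, |f x| ≤ δ := fun x hx => h.abs_le hx
  refine ⟨(gU_cont h.cont hM).neg, (gU_mono h.anti hM).neg, ?_, ?_⟩
  · simp_rw [neg_div]
    rw [intervalIntegral.integral_neg, gU_mean h.cont hM, h.mean, neg_zero]
  · have := gU_osc h.anti hM
    have := h.osc
    linarith

end

end

section
open Set Filter Topology

noncomputable section

/-- Weighted sums over pairs. -/
def Lam (a : ℕ → ℕ → ℝ) (N : ℕ) (f : ℝ → ℝ) : ℝ :=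
  ∑ p ∈ Finset.Icc 1 N, ∑ q ∈ Finset.Icc 1 p,
    a p q * (f ((q:ℝ) / p) / ((p:ℝ) * ((p:ℝ) + q)))

/-- Pairs of weights exchanged by one Euclid step. -/
structure SwapPair (w : ℕ) (a b : ℕ → ℕ → ℝ) : Prop where
  a0 : ∀ p q, 0 ≤ a p q
  a1 : ∀ p q, a p q ≤ 1
  b0 : ∀ p q, 0 ≤ b p q
  b1 : ∀ p q, b p q ≤ 1
  per : ∀ q p, b q (p + q) = b q p
  sw : ∀ p q, 1 ≤ q → q < p → w ≤ p → a p q = b q p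

lemma SwapPair.per_mul {w : ℕ} {a b : ℕ → ℕ → ℝ} (h : SwapPair w a b) (q c m : ℕ) :
    b q (q * m + c) = b q c := by
  induction m with
  | zero => simp
  | succ m ih =>
    rw [← ih, ← h.per q (q * m + c)]
    congr 1; ring

lemma tsum_residue (F : ℕ → ℝ) (q : ℕ) (hq : 1 ≤ q) (hF : Summable F) :
    ∑' n, F (q + 1 + n) = ∑ c ∈ Finset.Icc 1 q, ∑' m, F (q * (m + 1) + c) := by
  obtain ⟨k, rfl⟩ : ∃ k, q = k + 1 := ⟨q - 1, by omega⟩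
  have h1 : Summable (fun n => F (k + 1 + 1 + n)) := by
    have := (summable_nat_add_iff (k+1+1)).mpr hF
    refine this.congr (fun n => by congr 1; ring)
  rw [Nat.sumByResidueClasses h1 (k+1)]
  have e : ∀ j : ZMod (k+1), (∑' m, F (k + 1 + 1 + (j.val + (k+1) * m)))
      = (fun i : ℕ => ∑' m, F (k + 1 + 1 + (i + (k+1) * m))) (Fin.val (show Fin (k+1) from j)) := by
    intro j; rfl
  simp_rw [e]
  have := Fin.sum_univ_eq_sum_range (fun i : ℕ => ∑' m, F (k + 1 + 1 + (i + (k+1) * m))) (k+1)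
  refine this.trans ?_
  have e2 : Finset.Icc 1 (k+1) = Finset.Ico (0+1) (k+1+1) := by
    ext; simp only [Finset.mem_Icc, Finset.mem_Ico]; omega
  rw [e2, ← Finset.sum_Ico_add' , Finset.range_eq_Ico]
  refine Finset.sum_congr rfl (fun i _ => tsum_congr (fun m => ?_))
  congr 1; ring

lemma hasSum_tail (N : ℕ) (hN : 1 ≤ N) :
    HasSum (fun n : ℕ => 1 / ((N:ℝ) + n) - 1 / ((N:ℝ) + n + 1)) (1 / (N:ℝ)) := by
  have hN' : (1:ℝ) ≤ N := by exact_mod_cast hN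
  have h := hasSum_telescope (fun n : ℕ => 1 / ((N:ℝ) + n)) ?_ ?_
  · convert h using 1
    · funext n; push_cast; congr 2; ring
    · simp
  · apply Tendsto.const_div_atTop
    exact tendsto_atTop_add_const_left _ _ tendsto_natCast_atTop_atTop
  · intro m
    push_cast
    gcongr
    linarith

lemma tail_bound (F : ℕ → ℝ) (M : ℝ) (q N : ℕ) (hq : 1 ≤ q) (hqN : q ≤ N)
    (hF : ∀ p, q < p → |F p| ≤ M / (p:ℝ)^2) :
    |∑' n, F (q + 1 + n) - ∑ p ∈ Finset.Ioc q N, F p| ≤ M / N := by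
  have hM : 0 ≤ M := by
    have := (abs_nonneg _).trans (hF (q+1) (by omega))
    by_contra hneg
    push Not at hneg
    have : M / ((q+1:ℕ):ℝ)^2 < 0 := div_neg_of_neg_of_pos hneg (by positivity)
    linarith
  have hN' : (1:ℝ) ≤ N := by exact_mod_cast hq.trans hqN
  have ht : HasSum (fun n : ℕ => M * (1 / ((N:ℝ) + n) - 1 / ((N:ℝ) + n + 1))) (M / N) := by
    have := (hasSum_tail N (hq.trans hqN)).mul_left M
    rwa [mul_one_div] at this
  have hb : ∀ n : ℕ, ‖F (N + 1 + n)‖ ≤ M * (1 / ((N:ℝ) + n) - 1 / ((N:ℝ) + n + 1)) := by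
    intro n
    refine (hF _ (by omega)).trans ?_
    rw [div_eq_mul_one_div]
    apply mul_le_mul_of_nonneg_left _ hM
    push_cast
    have h1 : 0 < (N:ℝ) + n := by positivity
    rw [div_sub_div _ _ (by positivity) (by positivity), div_le_div_iff₀ (by positivity) (by positivity)]
    nlinarith
  have hs : Summable (fun n => F (N + 1 + n)) := Summable.of_norm_bounded ht.summable hb
  have hs' : Summable (fun n => F (q + 1 + n)) := by
    have : Summable F := by
      rw [← summable_nat_add_iff (N+1)]
      exact hs.congr (fun n => by congr 1; ring)
    have := (summable_nat_add_iff (q+1)).mpr this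
    refine this.congr (fun n => by congr 1; ring)
  have e := hs'.sum_add_tsum_nat_add (N - q)
  have e1 : ∑ i ∈ Finset.range (N - q), F (q + 1 + i) = ∑ p ∈ Finset.Ioc q N, F p := by
    rw [Finset.range_eq_Ico]
    have e2 : Finset.Ioc q N = Finset.Ico (0 + (q+1)) (N - q + (q+1)) := by
      ext; simp; omega
    rw [e2, ← Finset.sum_Ico_add']
    refine Finset.sum_congr rfl (fun i _ => by congr 1; ring)
  have e3 : ∑' i, F (q + 1 + (i + (N - q))) = ∑' n, F (N + 1 + n) := by
    apply tsum_congr; intro n; congr 1; omega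
  rw [← e, e1, e3, add_sub_cancel_left]
  exact tsum_of_norm_bounded ht hb

lemma swap_sum {w : ℕ} {a b : ℕ → ℕ → ℝ} (h : SwapPair w a b) (N : ℕ) (φ : ℕ → ℕ → ℝ) :
    |∑ p ∈ Finset.Icc 1 N, ∑ q ∈ Finset.Ico 1 p, a p q * φ p q
      - ∑ q ∈ Finset.Icc 1 N, ∑ p ∈ Finset.Ioc q N, b q p * φ p q|
    ≤ ∑ p ∈ Finset.Icc 1 w, ∑ q ∈ Finset.Ico 1 p, |φ p q| := by
  have e : ∑ q ∈ Finset.Icc 1 N, ∑ p ∈ Finset.Ioc q N, b q p * φ p q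
      = ∑ p ∈ Finset.Icc 1 N, ∑ q ∈ Finset.Ico 1 p, b q p * φ p q := by
    apply Finset.sum_comm'
    intro x y; simp; omega
  rw [e, ← Finset.sum_sub_distrib]
  have h1 : ∀ p q, 1 ≤ q → q < p → |a p q * φ p q - b q p * φ p q| ≤ if p ≤ w then |φ p q| else 0 := by
    intro p q hq hp
    rw [← sub_mul, abs_mul]
    split_ifs with hw
    · have : |a p q - b q p| ≤ 1 := by
        rw [abs_le]; constructor <;> linarith [h.a0 p q, h.a1 p q, h.b0 q p, h.b1 q p]
      exact mul_le_of_le_one_left (abs_nonneg _) this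
    · rw [h.sw p q hq hp (by omega)]; simp
  calc _ ≤ ∑ p ∈ Finset.Icc 1 N, ∑ q ∈ Finset.Ico 1 p, if p ≤ w then |φ p q| else 0 := by
        refine (Finset.abs_sum_le_sum_abs _ _).trans (Finset.sum_le_sum (fun p _ => ?_))
        rw [← Finset.sum_sub_distrib]
        refine (Finset.abs_sum_le_sum_abs _ _).trans (Finset.sum_le_sum (fun q hq => ?_))
        rw [Finset.mem_Ico] at hq
        exact h1 p q hq.1 hq.2
    _ = ∑ p ∈ (Finset.Icc 1 N).filter (· ≤ w), ∑ q ∈ Finset.Ico 1 p, |φ p q| := by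
        rw [Finset.sum_filter]
        refine Finset.sum_congr rfl (fun p _ => ?_)
        split_ifs <;> simp
    _ ≤ _ := by
        apply Finset.sum_le_sum_of_subset_of_nonneg
        · intro p; simp; omega
        · intros; exact Finset.sum_nonneg (fun _ _ => abs_nonneg _)

lemma harm_le (w : ℕ) (hw : 1 ≤ w) : ∑ p ∈ Finset.Icc 1 w, 1 / (p:ℝ) ≤ 1 + Real.log w := by
  have := harmonic_le_one_add_log w
  rw [harmonic_eq_sum_Icc] at this
  push_cast at this
  simpa using this

lemma sum_sq_le (N : ℕ) : ∑ p ∈ Finset.Icc 1 N, 1 / (p:ℝ)^2 ≤ 2 := by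
  have : ∀ n : ℕ, ∑ p ∈ Finset.Icc 1 (n+1), 1 / (p:ℝ)^2 ≤ 2 - 1 / ((n:ℝ)+1) := by
    intro n
    induction n with
    | zero => norm_num
    | succ n ih =>
      rw [Finset.sum_Icc_succ_top (by omega)]
      have : 1 / (((n+1+1:ℕ)):ℝ)^2 ≤ 1 / ((n:ℝ)+1) - 1 / ((n:ℝ)+1+1) := by
        push_cast
        rw [div_sub_div _ _ (by positivity) (by positivity), div_le_div_iff₀ (by positivity) (by positivity)]
        have : (0:ℝ) ≤ n := Nat.cast_nonneg n
        nlinarith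
      push_cast at *
      linarith
  rcases N with _ | n
  · norm_num
  · have h := this n
    have : 0 ≤ 1 / ((n:ℝ)+1) := by positivity
    linarith

lemma term_bound {f : ℝ → ℝ} {M : ℝ}
    (hM : ∀ x ∈ Icc (0:ℝ) 1, |f x| ≤ M) (p q : ℕ) (hp : 1 ≤ p) (hqp : q ≤ p) :
    |f ((q:ℝ) / p) / ((p:ℝ) * ((p:ℝ) + q))| ≤ M / (p:ℝ)^2 := by
  have hp' : (1:ℝ) ≤ p := by exact_mod_cast hp
  have hM0 : 0 ≤ M := (abs_nonneg _).trans (hM 0 (by simp))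
  have hx : (q:ℝ)/p ∈ Icc (0:ℝ) 1 := by
    constructor
    · positivity
    · rw [div_le_one (by positivity)]; exact_mod_cast hqp
  rw [abs_div, abs_of_pos (by positivity : 0 < (p:ℝ) * ((p:ℝ) + q))]
  apply div_le_div₀ hM0 (hM _ hx) (by positivity)
  have : (0:ℝ) ≤ q := Nat.cast_nonneg q
  nlinarith

lemma row_eq {w : ℕ} {a b : ℕ → ℕ → ℝ} (h : SwapPair w a b) {f : ℝ → ℝ} {M : ℝ}
    (hM : ∀ x ∈ Icc (0:ℝ) 1, |f x| ≤ M) (q : ℕ) (hq : 1 ≤ q) :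
    ∑ c ∈ Finset.Icc 1 q, b q c * (gU f ((c:ℝ) / q) / ((q:ℝ) * ((q:ℝ) + c)))
    = ∑' n, (fun p : ℕ => b q p * (f ((q:ℝ) / p) / ((p:ℝ) * ((p:ℝ) + q)))) (q + 1 + n) := by
  have hq' : (1:ℝ) ≤ q := by exact_mod_cast hq
  have hs : Summable (fun p : ℕ => b q p * (f ((q:ℝ) / p) / ((p:ℝ) * ((p:ℝ) + q)))) := by
    rw [← summable_nat_add_iff (q+1)]
    have h2 : Summable (fun n : ℕ => M * (1 / ((n + (q+1) : ℕ) : ℝ)^2)) :=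
      ((summable_nat_add_iff (q+1)).mpr
        (Real.summable_one_div_nat_pow.mpr (by norm_num : 1 < 2))).mul_left M
    refine Summable.of_norm_bounded h2 (fun n => ?_)
    rw [Real.norm_eq_abs, abs_mul, abs_of_nonneg (h.b0 q _), mul_one_div]
    exact (mul_le_of_le_one_left (abs_nonneg _) (h.b1 q _)).trans
      (term_bound hM _ q (by omega) (by omega))
  rw [tsum_residue _ q hq hs]
  refine Finset.sum_congr rfl (fun c hc => ?_)
  unfold gU
  rw [← tsum_div_const, ← tsum_mul_left]
  apply tsum_congr
  intro m
  rw [h.per_mul]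
  congr 1
  have e1 : (q:ℝ) / ((q * (m + 1) + c : ℕ) : ℝ) = 1 / ((m:ℝ) + 1 + (c:ℝ) / q) := by
    push_cast; field_simp
  rw [e1]
  set z := f (1 / ((m:ℝ) + 1 + (c:ℝ) / q))
  unfold gP
  have : (0:ℝ) ≤ c := Nat.cast_nonneg c
  have hA : (m:ℝ) + 1 + (c:ℝ) / q = (q * (m + 1) + c) / q := by field_simp
  have hB : (m:ℝ) + 2 + (c:ℝ) / q = (q * (m + 2) + c) / q := by field_simp
  have hC : 1 + (c:ℝ) / q = (q + c) / q := by field_simp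
  rw [hA, hB, hC]
  push_cast
  have h1 : (0:ℝ) < q * (m + 1) + c := by positivity
  have h2 : (0:ℝ) < q * (m + 2) + c := by positivity
  have h3 : (q:ℝ) * (m + 1) + c + q = q * (m + 2) + c := by ring
  rw [h3]
  field_simp

lemma Lam_swap {w : ℕ} (hw : 1 ≤ w) {a b : ℕ → ℕ → ℝ} (h : SwapPair w a b) {f : ℝ → ℝ} {M : ℝ}
    (hM : ∀ x ∈ Icc (0:ℝ) 1, |f x| ≤ M) (N : ℕ) :
    |Lam a N f - Lam b N (gU f)| ≤ 4 * M * (1 + Real.log w) := by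
  have hM0 : 0 ≤ M := (abs_nonneg _).trans (hM 0 (by simp))
  have hlw : 0 ≤ Real.log w := Real.log_nonneg (by exact_mod_cast hw)
  set φ : ℕ → ℕ → ℝ := fun p q => f ((q:ℝ) / p) / ((p:ℝ) * ((p:ℝ) + q)) with hφ
  have s1 : |Lam a N f - ∑ p ∈ Finset.Icc 1 N, ∑ q ∈ Finset.Ico 1 p, a p q * φ p q| ≤ 2 * M := by
    unfold Lam
    rw [← Finset.sum_sub_distrib]
    refine (Finset.abs_sum_le_sum_abs _ _).trans ?_
    calc _ ≤ ∑ p ∈ Finset.Icc 1 N, M * (1 / (p:ℝ)^2) := by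
          refine Finset.sum_le_sum (fun p hp => ?_)
          rw [Finset.mem_Icc] at hp
          rw [← Finset.sum_Ico_add_eq_sum_Icc hp.1, add_sub_cancel_left, abs_mul,
            abs_of_nonneg (h.a0 p p), mul_one_div]
          exact (mul_le_of_le_one_left (abs_nonneg _) (h.a1 p p)).trans
            (term_bound hM p p hp.1 le_rfl)
      _ ≤ _ := by
          rw [← Finset.mul_sum]
          nlinarith [sum_sq_le N]
  have s2 := swap_sum h N φ
  have s3 : ∑ p ∈ Finset.Icc 1 w, ∑ q ∈ Finset.Ico 1 p, |φ p q| ≤ M * (1 + Real.log w) := by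
    calc _ ≤ ∑ p ∈ Finset.Icc 1 w, M * (1 / (p:ℝ)) := by
          refine Finset.sum_le_sum (fun p hp => ?_)
          rw [Finset.mem_Icc] at hp
          have hp' : (1:ℝ) ≤ p := by exact_mod_cast hp.1
          calc _ ≤ ∑ q ∈ Finset.Ico 1 p, M / (p:ℝ)^2 := by
                refine Finset.sum_le_sum (fun q hq => ?_)
                rw [Finset.mem_Ico] at hq
                exact term_bound hM p q hp.1 hq.2.le
            _ = ((p - 1 : ℕ) : ℝ) * (M / (p:ℝ)^2) := by simp
            _ ≤ (p:ℝ) * (M / (p:ℝ)^2) := by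
                gcongr; omega
            _ = _ := by field_simp
      _ ≤ _ := by
          rw [← Finset.mul_sum]
          exact mul_le_mul_of_nonneg_left (harm_le w hw) hM0
  have s4 : |∑ q ∈ Finset.Icc 1 N, ∑ p ∈ Finset.Ioc q N, b q p * φ p q - Lam b N (gU f)| ≤ M := by
    unfold Lam
    rw [← Finset.sum_sub_distrib]
    refine (Finset.abs_sum_le_sum_abs _ _).trans ?_
    calc _ ≤ ∑ q ∈ Finset.Icc 1 N, M / (N:ℝ) := by
          refine Finset.sum_le_sum (fun q hq => ?_)
          rw [Finset.mem_Icc] at hq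
          rw [row_eq h hM q hq.1, abs_sub_comm]
          refine tail_bound (fun p => b q p * φ p q) M q N hq.1 hq.2 (fun p hp => ?_)
          rw [abs_mul, abs_of_nonneg (h.b0 q p)]
          exact (mul_le_of_le_one_left (abs_nonneg _) (h.b1 q p)).trans
            (term_bound hM p q (by omega) hp.le)
      _ ≤ M := by
          rw [Finset.sum_const, Nat.card_Icc, nsmul_eq_mul]
          rcases Nat.eq_zero_or_pos N with h0 | h0
          · subst h0; simpa using hM0
          · have : (0:ℝ) < N := by exact_mod_cast h0
            simp; field_simp; exact le_rfl
  rw [abs_le] at *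
  constructor <;> nlinarith

lemma Lam_neg (a : ℕ → ℕ → ℝ) (N : ℕ) (f : ℝ → ℝ) : Lam a N (fun x => - f x) = - Lam a N f := by
  unfold Lam
  simp_rw [neg_div, mul_neg, Finset.sum_neg_distrib]

lemma Lam_triv {w : ℕ} {a b : ℕ → ℕ → ℝ} (h : SwapPair w a b) {f : ℝ → ℝ} {M : ℝ}
    (hM : ∀ x ∈ Icc (0:ℝ) 1, |f x| ≤ M) (N : ℕ) : |Lam a N f| ≤ N * M := by
  have hM0 : 0 ≤ M := (abs_nonneg _).trans (hM 0 (by simp))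
  unfold Lam
  refine (Finset.abs_sum_le_sum_abs _ _).trans ?_
  calc _ ≤ ∑ p ∈ Finset.Icc 1 N, M := by
        refine Finset.sum_le_sum (fun p hp => ?_)
        rw [Finset.mem_Icc] at hp
        have hp' : (1:ℝ) ≤ p := by exact_mod_cast hp.1
        refine (Finset.abs_sum_le_sum_abs _ _).trans ?_
        calc _ ≤ ∑ q ∈ Finset.Icc 1 p, M / (p:ℝ)^2 := by
              refine Finset.sum_le_sum (fun q hq => ?_)
              rw [Finset.mem_Icc] at hq
              rw [abs_mul, abs_of_nonneg (h.a0 p q)]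
              exact (mul_le_of_le_one_left (abs_nonneg _) (h.a1 p q)).trans
                (term_bound hM p q hp.1 hq.2)
          _ = M / p := by simp; field_simp
          _ ≤ M := div_le_self hM0 hp'
    _ = _ := by simp

lemma Lam_iter {w : ℕ} (hw : 1 ≤ w) (N m : ℕ) : ∀ {a b : ℕ → ℕ → ℝ}, SwapPair w a b →
    SwapPair w b a → ∀ {f : ℝ → ℝ} {δ : ℝ}, GClass f δ →
    |Lam a N f| ≤ (8 * (1 + Real.log w) + N / 2 ^ m) * δ := by
  have hlw : 0 ≤ Real.log w := Real.log_nonneg (by exact_mod_cast hw)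
  induction m with
  | zero =>
    intro a b h h' f δ hf
    have hδ : 0 ≤ δ := (abs_nonneg _).trans (hf.abs_le (x := 0) (by simp))
    have := Lam_triv h (fun x hx => hf.abs_le hx) N
    have : 0 ≤ 8 * (1 + Real.log w) * δ := by positivity
    simp; linarith
  | succ m ih =>
    intro a b h h' f δ hf
    have hδ : 0 ≤ δ := (abs_nonneg _).trans (hf.abs_le (x := 0) (by simp))
    have h1 := Lam_swap hw h (fun x hx => hf.abs_le hx) N
    have h2 := ih h' h hf.step
    rw [Lam_neg, abs_neg] at h2
    have h3 : |Lam a N f| ≤ |Lam a N f - Lam b N (gU f)| + |Lam b N (gU f)| := by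
      have := abs_add_le (Lam a N f - Lam b N (gU f)) (Lam b N (gU f))
      simpa using this
    refine h3.trans ((add_le_add h1 h2).trans (le_of_eq ?_))
    rw [pow_succ]; field_simp; ring

lemma Lam_main {w : ℕ} (hw : 1 ≤ w) (N : ℕ) {a b : ℕ → ℕ → ℝ} (h : SwapPair w a b)
    (h' : SwapPair w b a) {f : ℝ → ℝ} {δ : ℝ} (hf : GClass f δ) :
    |Lam a N f| ≤ 8 * (1 + Real.log w) * δ := by
  have h1 : Tendsto (fun m : ℕ => (8 * (1 + Real.log w) + N / 2 ^ m) * δ) atTop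
      (𝓝 ((8 * (1 + Real.log w) + 0) * δ)) := by
    apply Tendsto.mul_const
    apply Tendsto.const_add
    have := (tendsto_pow_atTop_nhds_zero_of_lt_one (r := (1/2:ℝ)) (by norm_num) (by norm_num)).const_mul (N:ℝ)
    simpa [div_eq_mul_inv] using this
  rw [add_zero] at h1
  exact ge_of_tendsto' h1 (fun m => Lam_iter hw N m h h' hf)

end

end

section
open Set Filter Topology

noncomputable section

/-- Deviation of a branch from its mean. -/
def gd (m : ℕ) (x : ℝ) : ℝ := 1 / ((m:ℝ) + 2 + x) - Real.log (((m:ℝ) + 3) / ((m:ℝ) + 2))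

/-- The sum of the branch deviations. -/
def gD (x : ℝ) : ℝ := ∑' m : ℕ, gd m x

/-- The normalised deviation. -/
def fD (x : ℝ) : ℝ := (1 + x) * gD x

lemma log_branch (m : ℕ) : 1 / ((m:ℝ) + 3) ≤ Real.log (((m:ℝ) + 3) / ((m:ℝ) + 2)) ∧
    Real.log (((m:ℝ) + 3) / ((m:ℝ) + 2)) ≤ 1 / ((m:ℝ) + 2) := by
  constructor
  · have h := Real.one_sub_inv_le_log_of_pos (x := ((m:ℝ) + 3) / ((m:ℝ) + 2)) (by positivity)
    have e : 1 - (((m:ℝ) + 3) / ((m:ℝ) + 2))⁻¹ = 1 / ((m:ℝ) + 3) := by field_simp; ring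
    linarith
  · have h := Real.log_le_sub_one_of_pos (x := ((m:ℝ) + 3) / ((m:ℝ) + 2)) (by positivity)
    have e : ((m:ℝ) + 3) / ((m:ℝ) + 2) - 1 = 1 / ((m:ℝ) + 2) := by field_simp; ring
    linarith

lemma gd_bound (m : ℕ) {x : ℝ} (hx : x ∈ Icc (0:ℝ) 1) :
    |gd m x| ≤ 1 / ((m:ℝ) + 2)^2 := by
  obtain ⟨h1, h2⟩ := log_branch m
  have h3 : 1 / ((m:ℝ) + 3) ≤ 1 / ((m:ℝ) + 2 + x) := by
    apply one_div_le_one_div_of_le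
    · have := hx.1; positivity
    · linarith [hx.2]
  have h4 : 1 / ((m:ℝ) + 2 + x) ≤ 1 / ((m:ℝ) + 2) := by
    apply one_div_le_one_div_of_le
    · positivity
    · linarith [hx.1]
  have h5 : 1 / ((m:ℝ) + 2) - 1 / ((m:ℝ) + 3) ≤ 1 / ((m:ℝ) + 2)^2 := by
    rw [div_sub_div _ _ (by positivity) (by positivity), div_le_div_iff₀ (by positivity) (by positivity)]
    have : (0:ℝ) ≤ m := Nat.cast_nonneg m
    nlinarith
  unfold gd
  rw [abs_le]; constructor <;> linarith

lemma gd_bound' (m : ℕ) {x : ℝ} (hx : x ∈ Icc (0:ℝ) 1) :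
    |gd m x| ≤ 2 / (((m : ℝ) + 1) * ((m : ℝ) + 2)) := by
  refine (gd_bound m hx).trans ?_
  rw [div_le_div_iff₀ (by positivity) (by positivity)]
  have : (0:ℝ) ≤ m := Nat.cast_nonneg m
  nlinarith

lemma gd_summable {x : ℝ} (hx : x ∈ Icc (0:ℝ) 1) : Summable (fun m => gd m x) :=
  Summable.of_norm_bounded summable_bd (fun m => gd_bound' m hx)

lemma gd_cont (m : ℕ) : ContinuousOn (gd m) (Icc 0 1) := by
  unfold gd
  apply ContinuousOn.sub _ continuousOn_const
  refine ContinuousOn.div (by fun_prop) (by fun_prop) (fun x hx => ?_)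
  have := hx.1; positivity

lemma gD_bound {x : ℝ} (hx : x ∈ Icc (0:ℝ) 1) : |gD x| ≤ 2 := by
  unfold gD
  rw [← Real.norm_eq_abs]
  have h : HasSum (fun m : ℕ => 2 / (((m : ℝ) + 1) * ((m : ℝ) + 2))) 2 := by
    have := (hasSum_gP (x := 0) (by simp)).mul_left 2
    rw [mul_one] at this
    refine this.congr_fun ?_
    intro m
    simp [gP]; field_simp
  exact tsum_of_norm_bounded h (fun m => gd_bound' m hx)

lemma fD_class : GClass fD 6 := by
  refine ⟨?_, ?_, ?_, ?_⟩
  · unfold fD gD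
    apply ContinuousOn.mul (by fun_prop)
    exact continuousOn_tsum gd_cont summable_bd (fun m x hx => gd_bound' m hx)
  · intro x hx y hy hxy
    have h0 := hx.1
    unfold fD gD
    rw [← tsum_mul_left, ← tsum_mul_left]
    refine Summable.tsum_le_tsum (fun m => ?_) ((gd_summable hy).mul_left _)
      ((gd_summable hx).mul_left _)
    unfold gd
    obtain ⟨h1, h2⟩ := log_branch m
    set l := Real.log (((m:ℝ) + 3) / ((m:ℝ) + 2))
    have hy0 := hy.1
    have ex : (1 + x) * (1 / ((m:ℝ) + 2 + x)) = 1 - ((m:ℝ)+1) / ((m:ℝ) + 2 + x) := by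
      field_simp; ring
    have ey : (1 + y) * (1 / ((m:ℝ) + 2 + y)) = 1 - ((m:ℝ)+1) / ((m:ℝ) + 2 + y) := by
      field_simp; ring
    have hk : ((m:ℝ)+1) / ((m:ℝ) + 2 + x) - ((m:ℝ)+1) / ((m:ℝ) + 2 + y) ≤ (y - x) * (1 / ((m:ℝ) + 3)) := by
      have : ((m:ℝ)+1) / ((m:ℝ) + 2 + x) - ((m:ℝ)+1) / ((m:ℝ) + 2 + y)
          = (y - x) * (((m:ℝ)+1) / (((m:ℝ) + 2 + x) * ((m:ℝ) + 2 + y))) := by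
        field_simp; ring
      rw [this]
      apply mul_le_mul_of_nonneg_left _ (by linarith)
      rw [div_le_div_iff₀ (by positivity) (by positivity)]
      have : (0:ℝ) ≤ m := Nat.cast_nonneg m
      have : ((m:ℝ) + 2) * ((m:ℝ) + 2) ≤ ((m:ℝ) + 2 + x) * ((m:ℝ) + 2 + y) := by
        apply mul_le_mul <;> first | linarith | positivity
      nlinarith
    have := mul_le_mul_of_nonneg_left h1 (by linarith : 0 ≤ y - x)
    rw [mul_sub, mul_sub, ex, ey]
    linarith
  · have e : ∫ x in (0:ℝ)..1, fD x / (1 + x) = ∫ x in (0:ℝ)..1, gD x := by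
      apply intervalIntegral.integral_congr
      intro x hx
      rw [uIcc_of_le zero_le_one] at hx
      have := hx.1
      simp only [fD]
      field_simp
    rw [e]
    have h := hasSum_integral01 gd _ summable_bd gd_cont (fun m x hx => gd_bound' m hx)
    have h0 : ∀ m : ℕ, ∫ x in (0:ℝ)..1, gd m x = 0 := by
      intro m
      unfold gd
      rw [intervalIntegral.integral_sub _ (by simp)]
      · have := intervalIntegral.integral_comp_add_left (a := 0) (b := 1) (fun x : ℝ => 1 / x) ((m:ℝ)+2)
        rw [this, integral_one_div_of_pos (by positivity) (by positivity)]
        simp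
        have e3 : (m:ℝ) + 2 + 1 = m + 3 := by ring
        rw [e3]; simp
      · apply ContinuousOn.intervalIntegrable
        rw [uIcc_of_le zero_le_one]
        refine ContinuousOn.div (by fun_prop) (by fun_prop) (fun x hx => ?_)
        have := hx.1; positivity
    simp_rw [h0] at h
    exact h.unique hasSum_zero
  · have h1 := gD_bound (x := 0) (by simp)
    have h2 := gD_bound (x := 1) (by simp)
    rw [abs_le] at h1 h2
    unfold fD
    linarith [h1.2, h2.1]

lemma div_eq_of (q m c : ℕ) (hc : 1 ≤ c) (hcq : c ≤ q) : (q * (m + 1) + c - 1) / q = m + 1 := by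
  apply Nat.div_eq_of_lt_le
  · rw [mul_comm]; omega
  · have : (m + 1 + 1) * q = q * (m+1) + q := by ring
    omega

lemma decomp (q p : ℕ) (hq : 1 ≤ q) (hp : q < p) : ∃ m c, 1 ≤ c ∧ c ≤ q ∧ p = q * (m + 1) + c := by
  have h1 := Nat.div_add_mod (p - 1 - q) q
  have h2 := Nat.mod_lt (p - 1 - q) (show q > 0 by omega)
  refine ⟨(p - 1 - q) / q, (p - 1 - q) % q + 1, by omega, by omega, ?_⟩
  have : q * ((p - 1 - q) / q + 1) = q * ((p - 1 - q) / q) + q := by ring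
  omega

/-- Branch logarithm. -/
def bl (q p : ℕ) : ℝ := Real.log ((((p - 1) / q : ℕ) + 2 : ℝ) / (((p - 1) / q : ℕ) + 1))

lemma bl_eq (q m c : ℕ) (hc : 1 ≤ c) (hcq : c ≤ q) :
    bl q (q * (m + 1) + c) = Real.log (((m:ℝ) + 3) / ((m:ℝ) + 2)) := by
  unfold bl
  rw [div_eq_of q m c hc hcq]
  push_cast
  congr 2 <;> ring

lemma gd_eq (q m c : ℕ) (hc : 1 ≤ c) (hcq : c ≤ q) :
    1 / ((q:ℝ) * (((q * (m + 1) + c : ℕ):ℝ) + q)) - bl q (q * (m + 1) + c) / (q:ℝ)^2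
      = gd m ((c:ℝ) / q) / (q:ℝ)^2 := by
  rw [bl_eq q m c hc hcq]
  unfold gd
  have hq : (1:ℝ) ≤ q := by exact_mod_cast hc.trans hcq
  push_cast
  rw [sub_div]
  congr 1
  have : (0:ℝ) ≤ c := Nat.cast_nonneg c
  have e : (m:ℝ) + 2 + (c:ℝ) / q = (q * (m + 2) + c) / q := by field_simp
  have e2 : (q:ℝ) * (m + 1) + c + q = q * (m + 2) + c := by ring
  rw [e, e2]
  have h2 : (0:ℝ) < q * (m + 2) + c := by positivity
  field_simp

lemma cq_mem (q c : ℕ) (hc : 1 ≤ c) (hcq : c ≤ q) : (c:ℝ) / q ∈ Icc (0:ℝ) 1 := by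
  have hq : (1:ℝ) ≤ q := by exact_mod_cast hc.trans hcq
  constructor
  · positivity
  · rw [div_le_one (by positivity)]; exact_mod_cast hcq

lemma F1_bound (q p : ℕ) (hq : 1 ≤ q) (hp : q < p) :
    |1 / ((q:ℝ) * ((p:ℝ) + q)) - bl q p / (q:ℝ)^2| ≤ 1 / (p:ℝ)^2 := by
  obtain ⟨m, c, hc, hcq, rfl⟩ := decomp q p hq hp
  have hq : (1:ℝ) ≤ q := by exact_mod_cast hc.trans hcq
  rw [gd_eq q m c hc hcq, abs_div, abs_of_pos (by positivity : 0 < (q:ℝ)^2)]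
  calc _ ≤ 1 / ((m:ℝ) + 2)^2 / (q:ℝ)^2 := by
        gcongr; exact gd_bound m (cq_mem q c hc hcq)
    _ = 1 / ((q:ℝ) * (m + 2))^2 := by rw [div_div]; congr 1; ring
    _ ≤ _ := by
        push_cast
        have : (c:ℝ) ≤ q := by exact_mod_cast hcq
        have : (1:ℝ) ≤ c := by exact_mod_cast hc
        gcongr
        nlinarith

lemma row1 {w : ℕ} {a b : ℕ → ℕ → ℝ} (h : SwapPair w a b) (q : ℕ) (hq : 1 ≤ q) :
    ∑' n, (fun p : ℕ => b q p * (1 / ((q:ℝ) * ((p:ℝ) + q)) - bl q p / (q:ℝ)^2)) (q + 1 + n)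
    = ∑ c ∈ Finset.Icc 1 q, b q c * (fD ((c:ℝ) / q) / ((q:ℝ) * ((q:ℝ) + c))) := by
  have hq' : (1:ℝ) ≤ q := by exact_mod_cast hq
  have hs : Summable (fun p : ℕ => b q p * (1 / ((q:ℝ) * ((p:ℝ) + q)) - bl q p / (q:ℝ)^2)) := by
    rw [← summable_nat_add_iff (q+1)]
    have h2 : Summable (fun n : ℕ => (1 / ((n + (q+1) : ℕ) : ℝ)^2)) :=
      (summable_nat_add_iff (f := fun n : ℕ => 1 / (n:ℝ)^2) (q+1)).mpr
        (Real.summable_one_div_nat_pow.mpr (by norm_num : 1 < 2))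
    refine Summable.of_norm_bounded h2 (fun n => ?_)
    rw [Real.norm_eq_abs, abs_mul, abs_of_nonneg (h.b0 q _)]
    exact (mul_le_of_le_one_left (abs_nonneg _) (h.b1 q _)).trans
      (F1_bound q _ hq (by omega))
  rw [tsum_residue _ q hq hs]
  refine Finset.sum_congr rfl (fun c hc => ?_)
  rw [Finset.mem_Icc] at hc
  have e : ∀ m : ℕ, b q (q * (m + 1) + c) * (1 / ((q:ℝ) * (((q * (m + 1) + c : ℕ):ℝ) + q)) - bl q (q * (m + 1) + c) / (q:ℝ)^2)
      = b q c * (gd m ((c:ℝ) / q) / (q:ℝ)^2) := by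
    intro m
    rw [gd_eq q m c hc.1 hc.2, h.per_mul]
  simp_rw [e]
  rw [tsum_mul_left, tsum_div_const]
  congr 1
  unfold fD gD
  have : (0:ℝ) ≤ c := Nat.cast_nonneg c
  have h1 : (0:ℝ) < q + c := by positivity
  have hC : 1 + (c:ℝ) / q = (q + c) / q := by field_simp
  rw [hC]
  field_simp

lemma sum_log_branch (J : ℕ) : ∑ m ∈ Finset.range J, Real.log (((m:ℝ) + 3) / ((m:ℝ) + 2))
    = Real.log ((J:ℝ) + 2) - Real.log 2 := by
  induction J with
  | zero => simp
  | succ J ih =>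
    rw [Finset.sum_range_succ, ih, Real.log_div (by positivity) (by positivity)]
    push_cast
    have : (J:ℝ) + 1 + 2 = J + 3 := by ring
    rw [this]; ring

lemma row2 {w : ℕ} {a b : ℕ → ℕ → ℝ} (h : SwapPair w a b) (q N : ℕ) (hq : 1 ≤ q) (hqN : q ≤ N) :
    ∑ p ∈ Finset.Ioc q N, b q p * bl q p
    = ∑ c ∈ Finset.Icc 1 q, b q c * (Real.log (((N - c) / q : ℕ) + 2) - Real.log 2) := by
  set F : ℕ → ℝ := fun p => if p ≤ N then b q p * bl q p else 0 with hF
  have hfin : ∀ p, p ∉ Finset.range (N+1) → F p = 0 := by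
    intro p hp
    simp only [Finset.mem_range] at hp
    simp only [hF]; rw [if_neg (by omega)]
  have hs : Summable F := summable_of_ne_finset_zero (s := Finset.range (N+1)) hfin
  have h1 := tsum_residue F q hq hs
  have e1 : ∑' n, F (q + 1 + n) = ∑ p ∈ Finset.Ioc q N, b q p * bl q p := by
    rw [tsum_eq_sum (s := Finset.range (N - q))]
    · rw [Finset.range_eq_Ico]
      have e2 : Finset.Ioc q N = Finset.Ico (0 + (q+1)) (N - q + (q+1)) := by
        ext; simp; omega
      rw [e2, ← Finset.sum_Ico_add']
      refine Finset.sum_congr rfl (fun i hi => ?_)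
      rw [Finset.mem_Ico] at hi
      simp only [hF]
      rw [if_pos (by omega), add_comm i]
    · intro n hn
      rw [Finset.mem_range] at hn
      simp only [hF]; rw [if_neg (by omega)]
  rw [← e1, h1]
  refine Finset.sum_congr rfl (fun c hc => ?_)
  rw [Finset.mem_Icc] at hc
  rw [← sum_log_branch, Finset.mul_sum, tsum_eq_sum (s := Finset.range ((N - c) / q))]
  · refine Finset.sum_congr rfl (fun m hm => ?_)
    rw [Finset.mem_range, Nat.lt_iff_add_one_le, Nat.le_div_iff_mul_le (by omega)] at hm
    simp only [hF]
    rw [if_pos (by rw [mul_comm]; omega), h.per_mul, bl_eq q m c hc.1 hc.2]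
  · intro m hm
    rw [Finset.mem_range, Nat.lt_iff_add_one_le, Nat.le_div_iff_mul_le (by omega)] at hm
    simp only [hF]
    rw [if_neg (by rw [mul_comm]; omega)]

lemma log_J (U : ℝ) (hU : 1 ≤ U) (q c : ℕ) (hc : 1 ≤ c) (hcq : c ≤ q) (hqN : q ≤ ⌊U⌋₊) :
    |Real.log (((⌊U⌋₊ - c) / q : ℕ) + 2) - Real.log (U / q)| ≤ 2 * q / U := by
  have hq : (1:ℝ) ≤ q := by exact_mod_cast hc.trans hcq
  set N := ⌊U⌋₊
  set J := (N - c) / q with hJ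
  have h1 : q * J ≤ N - c := Nat.mul_div_le _ _
  have h2 : N - c < q * (J + 1) := Nat.lt_mul_div_succ _ (by omega)
  have h3 : N + 1 ≤ q * (J + 2) := by
    have : q * (J + 2) = q * (J + 1) + q := by ring
    omega
  have h4 : q * J ≤ N := by omega
  have h5 : (N:ℝ) ≤ U := Nat.floor_le (by linarith)
  have h6 : U < N + 1 := Nat.lt_floor_add_one U
  have h3' : (N:ℝ) + 1 ≤ q * (J + 2) := by exact_mod_cast h3
  have h4' : (q:ℝ) * J ≤ N := by exact_mod_cast h4
  have hUq : 0 < U / q := by positivity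
  rw [← Real.log_div (by positivity) hUq.ne']
  have hr : ((J:ℝ) + 2) / (U / q) = q * (J + 2) / U := by field_simp
  rw [hr]
  have hge : 1 ≤ q * ((J:ℝ) + 2) / U := by
    rw [one_le_div (by positivity)]; linarith
  rw [abs_of_nonneg (Real.log_nonneg hge)]
  refine (Real.log_le_sub_one_of_pos (by positivity)).trans ?_
  rw [div_sub_one (by positivity)]
  apply div_le_div_of_nonneg_right _ (by positivity)
  nlinarith

lemma swap_main {w : ℕ} (hw : 1 ≤ w) {a b : ℕ → ℕ → ℝ} (h : SwapPair w a b)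
    (h' : SwapPair w b a) (U : ℝ) (hU : 1 ≤ U) :
    |∑ p ∈ Finset.Icc 1 ⌊U⌋₊, ∑ q ∈ Finset.Ico 1 p, a p q * (1 / ((q:ℝ) * ((p:ℝ) + q)))
      - ∑ q ∈ Finset.Icc 1 ⌊U⌋₊, (∑ c ∈ Finset.Icc 1 q, b q c) / (q:ℝ)^2 *
          (Real.log (U / q) - Real.log 2)| ≤ 52 * (1 + Real.log w)^2 := by
  have hlw : 0 ≤ Real.log w := Real.log_nonneg (by exact_mod_cast hw)
  set N := ⌊U⌋₊ with hN
  have hN1 : 1 ≤ N := Nat.le_floor (by simpa using hU)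
  have hN0 : (0:ℝ) < N := by exact_mod_cast hN1
  have s1 := swap_sum h N (fun p q => 1 / ((q:ℝ) * ((p:ℝ) + q)))
  have s2 : ∑ p ∈ Finset.Icc 1 w, ∑ q ∈ Finset.Ico 1 p, |1 / ((q:ℝ) * ((p:ℝ) + q))|
      ≤ (1 + Real.log w)^2 := by
    calc _ ≤ ∑ p ∈ Finset.Icc 1 w, ∑ q ∈ Finset.Icc 1 w, (1 / (p:ℝ)) * (1 / (q:ℝ)) := by
          refine Finset.sum_le_sum (fun p hp => ?_)
          rw [Finset.mem_Icc] at hp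
          have hp' : (1:ℝ) ≤ p := by exact_mod_cast hp.1
          calc _ ≤ ∑ q ∈ Finset.Ico 1 p, (1 / (p:ℝ)) * (1 / (q:ℝ)) := by
                refine Finset.sum_le_sum (fun q hq => ?_)
                rw [Finset.mem_Ico] at hq
                have hq' : (1:ℝ) ≤ q := by exact_mod_cast hq.1
                rw [abs_of_nonneg (by positivity), one_div_mul_one_div]
                apply one_div_le_one_div_of_le (by positivity)
                nlinarith
            _ ≤ _ := by
                apply Finset.sum_le_sum_of_subset_of_nonneg
                · intro x; simp; omega
                · intros; positivity
      _ = (∑ p ∈ Finset.Icc 1 w, 1 / (p:ℝ))^2 := by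
          rw [sq, Finset.sum_mul_sum]
      _ ≤ _ := by
          apply pow_le_pow_left₀ _ (harm_le w hw)
          exact Finset.sum_nonneg (fun _ _ => by positivity)
  have s3 : |∑ q ∈ Finset.Icc 1 N, ∑ p ∈ Finset.Ioc q N,
      b q p * (1 / ((q:ℝ) * ((p:ℝ) + q)) - bl q p / (q:ℝ)^2) - Lam b N fD| ≤ 1 := by
    unfold Lam
    rw [← Finset.sum_sub_distrib]
    refine (Finset.abs_sum_le_sum_abs _ _).trans ?_
    calc _ ≤ ∑ q ∈ Finset.Icc 1 N, 1 / (N:ℝ) := by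
          refine Finset.sum_le_sum (fun q hq => ?_)
          rw [Finset.mem_Icc] at hq
          rw [← row1 h q hq.1, abs_sub_comm]
          refine tail_bound (fun p => b q p * (1 / ((q:ℝ) * ((p:ℝ) + q)) - bl q p / (q:ℝ)^2))
            1 q N hq.1 hq.2 (fun p hp => ?_)
          rw [abs_mul, abs_of_nonneg (h.b0 q p)]
          exact (mul_le_of_le_one_left (abs_nonneg _) (h.b1 q p)).trans
            (F1_bound q p hq.1 hp)
      _ ≤ 1 := by
          rw [Finset.sum_const, Nat.card_Icc, nsmul_eq_mul]
          simp; field_simp; exact le_rfl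
  have s4 := Lam_main hw N h' h fD_class
  have s5 : |∑ q ∈ Finset.Icc 1 N, ∑ p ∈ Finset.Ioc q N, b q p * (bl q p / (q:ℝ)^2)
      - ∑ q ∈ Finset.Icc 1 N, (∑ c ∈ Finset.Icc 1 q, b q c) / (q:ℝ)^2 *
          (Real.log (U / q) - Real.log 2)| ≤ 2 := by
    rw [← Finset.sum_sub_distrib]
    refine (Finset.abs_sum_le_sum_abs _ _).trans ?_
    calc _ ≤ ∑ q ∈ Finset.Icc 1 N, 2 / (U:ℝ) := by
          refine Finset.sum_le_sum (fun q hq => ?_)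
          rw [Finset.mem_Icc] at hq
          have hq' : (1:ℝ) ≤ q := by exact_mod_cast hq.1
          have e1 : ∑ p ∈ Finset.Ioc q N, b q p * (bl q p / (q:ℝ)^2)
              = (∑ p ∈ Finset.Ioc q N, b q p * bl q p) / (q:ℝ)^2 := by
            rw [Finset.sum_div]; refine Finset.sum_congr rfl (fun p _ => by ring)
          rw [e1, row2 h q N hq.1 hq.2, div_mul_eq_mul_div, ← sub_div, Finset.sum_mul,
            ← Finset.sum_sub_distrib, abs_div, abs_of_pos (by positivity : 0 < (q:ℝ)^2),
            div_le_iff₀ (by positivity)]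
          refine (Finset.abs_sum_le_sum_abs _ _).trans ?_
          calc _ ≤ ∑ c ∈ Finset.Icc 1 q, 2 * (q:ℝ) / U := by
                refine Finset.sum_le_sum (fun c hc => ?_)
                rw [Finset.mem_Icc] at hc
                rw [← mul_sub, abs_mul, abs_of_nonneg (h.b0 q c), sub_sub_sub_cancel_right]
                exact (mul_le_of_le_one_left (abs_nonneg _) (h.b1 q c)).trans
                  (log_J U hU q c hc.1 hc.2 hq.2)
            _ = _ := by simp; ring
      _ ≤ 2 := by
          rw [Finset.sum_const, Nat.card_Icc, nsmul_eq_mul]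
          have : (N:ℝ) ≤ U := Nat.floor_le (by linarith)
          simp
          rw [mul_div_assoc', div_le_iff₀ (by positivity)]
          linarith
  have s6 : ∑ q ∈ Finset.Icc 1 N, ∑ p ∈ Finset.Ioc q N, b q p * (1 / ((q:ℝ) * ((p:ℝ) + q)))
      = ∑ q ∈ Finset.Icc 1 N, ∑ p ∈ Finset.Ioc q N,
        b q p * (1 / ((q:ℝ) * ((p:ℝ) + q)) - bl q p / (q:ℝ)^2)
        + ∑ q ∈ Finset.Icc 1 N, ∑ p ∈ Finset.Ioc q N, b q p * (bl q p / (q:ℝ)^2) := by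
    rw [← Finset.sum_add_distrib]
    refine Finset.sum_congr rfl (fun q _ => ?_)
    rw [← Finset.sum_add_distrib]
    refine Finset.sum_congr rfl (fun p _ => by ring)
  rw [s6] at s1
  have s1' := s1.trans s2
  rw [abs_le] at *
  constructor <;> nlinarith

end

end

section
open Set Filter Topology

noncomputable section

lemma modInv_spec (p q : ℕ) (hp : 1 ≤ p) (h : Nat.Coprime p q) :
    1 ≤ modInv p q ∧ modInv p q ≤ p ∧ modInv p q * q ≡ 1 [MOD p] := by
  have : NeZero p := ⟨by omega⟩
  have hc : ((modInv p q : ℕ) : ZMod p) = (q : ZMod p)⁻¹ := by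
    unfold modInv
    split_ifs with h0
    · rw [ZMod.natCast_self]
      have := (ZMod.val_eq_zero _).mp h0
      exact this.symm
    · rw [ZMod.natCast_zmod_val]
  refine ⟨?_, ?_, ?_⟩
  · unfold modInv; split_ifs <;> omega
  · unfold modInv; split_ifs
    · omega
    · exact (ZMod.val_lt _).le
  · rw [← ZMod.natCast_eq_natCast_iff]
    push_cast
    rw [hc, mul_comm]
    exact ZMod.coe_mul_inv_eq_one q h.symm

lemma modInv_unique (p q x : ℕ) (h : Nat.Coprime p q) (hx : 1 ≤ x) (hx' : x ≤ p)
    (hm : x * q ≡ 1 [MOD p]) : x = modInv p q := by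
  obtain ⟨h1, h2, h3⟩ := modInv_spec p q (by omega) h
  have e : x ≡ modInv p q [MOD p] := by
    apply Nat.ModEq.cancel_right_of_coprime (c := q) h
    exact hm.trans h3.symm
  rcases Nat.lt_or_ge x p with hx2 | hx2
  · rcases Nat.lt_or_ge (modInv p q) p with hy | hy
    · exact Nat.ModEq.eq_of_lt_of_lt e hx2 hy
    · have : modInv p q = p := by omega
      rw [this] at e
      have := (Nat.modEq_zero_iff_dvd.mp (e.trans (by simp [Nat.ModEq])))
      have := Nat.le_of_dvd (by omega) this
      omega
  · have hxp : x = p := by omega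
    rw [hxp] at e
    have := (Nat.modEq_zero_iff_dvd.mp (e.symm.trans (by simp [Nat.ModEq])))
    have := Nat.le_of_dvd (by omega) this
    omega

lemma modInv_recip (p q : ℕ) (hp : 1 ≤ p) (hq : 1 ≤ q) (h : Nat.Coprime p q) :
    modInv p q * q + modInv q p * p = p * q + 1 := by
  obtain ⟨a1, a2, a3⟩ := modInv_spec p q hp h
  obtain ⟨b1, b2, b3⟩ := modInv_spec q p hq h.symm
  set a := modInv p q
  set b := modInv q p
  have m1 : a * q + b * p ≡ 1 [MOD p] := by
    have : b * p ≡ 0 [MOD p] := by simp [Nat.ModEq]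
    simpa using a3.add this
  have m2 : a * q + b * p ≡ 1 [MOD q] := by
    have : a * q ≡ 0 [MOD q] := by simp [Nat.ModEq]
    simpa using this.add b3
  have m3 : a * q + b * p ≡ 1 [MOD p * q] := (Nat.modEq_and_modEq_iff_modEq_mul h).mp ⟨m1, m2⟩
  have l1 : a * q ≤ p * q := Nat.mul_le_mul_right _ a2
  have l2 : b * p ≤ p * q := by rw [mul_comm p q]; exact Nat.mul_le_mul_right _ b2
  have l3 : 1 ≤ a * q := Nat.mul_pos a1 hq
  have l4 : 1 ≤ b * p := Nat.mul_pos b1 hp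
  have hd : p * q ∣ (a * q + b * p) - 1 := (Nat.modEq_iff_dvd' (by omega)).mp m3.symm
  obtain ⟨k, hk⟩ := hd
  have : k = 1 := by
    have k0 : k ≠ 0 := by rintro rfl; simp at hk; omega
    have k2 : k < 2 := by
      by_contra hh
      push Not at hh
      have : p * q * 2 ≤ p * q * k := Nat.mul_le_mul_left _ hh
      omega
    omega
  subst this
  omega

lemma modInv_add (p q : ℕ) : modInv p (q + p) = modInv p q := by
  unfold modInv
  simp

open Classical in
/-- The weight of Case 3. -/
def wA (α : ℚ) (p q : ℕ) : ℝ :=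
  if Nat.Coprime p q ∧ (modInv p q : ℝ) ≤ (α:ℝ) * p then 1 else 0

open Classical in
/-- The dual weight. -/
def wB (α : ℚ) (p q : ℕ) : ℝ :=
  if Nat.Coprime p q ∧ (p:ℝ) - modInv p q < (α:ℝ) * p then 1 else 0

lemma rat_gap (α : ℚ) (x : ℤ) (q : ℕ) (h : (x:ℝ) < (α:ℝ) * q) :
    (x:ℝ) + 1 / α.den ≤ (α:ℝ) * q := by
  have hd : (0:ℝ) < α.den := by exact_mod_cast α.den_pos
  have e : (α:ℝ) = α.num / α.den := by exact_mod_cast (Rat.num_div_den α).symm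
  rw [e] at h ⊢
  have h1 : (x:ℝ) * α.den < α.num * q := by
    rw [div_mul_eq_mul_div, lt_div_iff₀ hd] at h; exact h
  have h2 : x * α.den + 1 ≤ α.num * q := by
    have : x * α.den < α.num * q := by exact_mod_cast h1
    omega
  have h3 : (x:ℝ) * α.den + 1 ≤ α.num * q := by exact_mod_cast h2
  rw [div_mul_eq_mul_div, le_div_iff₀ hd]
  field_simp
  linarith

lemma rat_gap' (α : ℚ) (x : ℤ) (q : ℕ) (h : (α:ℝ) * q < x) :
    (α:ℝ) * q + 1 / α.den ≤ x := by
  have := rat_gap (-α) (-x) q (by push_cast; linarith)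
  push_cast at this
  simp only [Rat.den_neg_eq_den] at this
  linarith

lemma swapAB (α : ℚ) : SwapPair α.den (wA α) (wB α) where
  a0 p q := by unfold wA; split_ifs <;> norm_num
  a1 p q := by unfold wA; split_ifs <;> norm_num
  b0 p q := by unfold wB; split_ifs <;> norm_num
  b1 p q := by unfold wB; split_ifs <;> norm_num
  per q p := by unfold wB; simp only [modInv_add, Nat.coprime_add_self_right]
  sw p q hq hp hw := by
    unfold wA wB
    by_cases hc : Nat.Coprime p q
    · have hr := modInv_recip p q (by omega) hq hc
      have hr' : (modInv p q:ℝ) * q + modInv q p * p = p * q + 1 := by exact_mod_cast hr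
      have hp0 : (0:ℝ) < p := by exact_mod_cast (by omega : 0 < p)
      have hq0 : (0:ℝ) < q := by exact_mod_cast hq
      have hd : (0:ℝ) < α.den := by exact_mod_cast α.den_pos
      have hw' : (α.den:ℝ) ≤ p := by exact_mod_cast hw
      have : (modInv p q : ℝ) ≤ (α:ℝ) * p ↔ (q:ℝ) - modInv q p < (α:ℝ) * q := by
        constructor
        · intro h
          have := mul_le_mul_of_nonneg_right h hq0.le
          by_contra hh
          push Not at hh
          have := mul_le_mul_of_nonneg_right hh hp0.le
          nlinarith
        · intro h
          have g := rat_gap α ((q:ℤ) - modInv q p) q (by push_cast; exact h)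
          push_cast at g
          have g2 : 1 / (p:ℝ) ≤ 1 / α.den := one_div_le_one_div_of_le hd hw'
          have g3 : (q:ℝ) - modInv q p + 1/p ≤ α * q := by linarith
          have g4 := mul_le_mul_of_nonneg_right g3 hp0.le
          have g5 : 1 / (p:ℝ) * p = 1 := by field_simp
          by_contra hh
          push Not at hh
          have := mul_lt_mul_of_pos_right hh hq0
          nlinarith
      have e : Nat.Coprime p q ↔ Nat.Coprime q p := Nat.coprime_comm
      simp only [e, this]
    · have hc' : ¬ Nat.Coprime q p := fun h => hc h.symm
      simp [hc, hc']

lemma swapBA (α : ℚ) : SwapPair α.den (wB α) (wA α) where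
  a0 p q := by unfold wB; split_ifs <;> norm_num
  a1 p q := by unfold wB; split_ifs <;> norm_num
  b0 p q := by unfold wA; split_ifs <;> norm_num
  b1 p q := by unfold wA; split_ifs <;> norm_num
  per q p := by unfold wA; simp only [modInv_add, Nat.coprime_add_self_right]
  sw p q hq hp hw := by
    unfold wA wB
    by_cases hc : Nat.Coprime p q
    · have hr := modInv_recip p q (by omega) hq hc
      have hr' : (modInv p q:ℝ) * q + modInv q p * p = p * q + 1 := by exact_mod_cast hr
      have hp0 : (0:ℝ) < p := by exact_mod_cast (by omega : 0 < p)
      have hq0 : (0:ℝ) < q := by exact_mod_cast hq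
      have hd : (0:ℝ) < α.den := by exact_mod_cast α.den_pos
      have hw' : (α.den:ℝ) ≤ p := by exact_mod_cast hw
      have : (p:ℝ) - modInv p q < (α:ℝ) * p ↔ (modInv q p:ℝ) ≤ (α:ℝ) * q := by
        constructor
        · intro h
          by_contra hh
          push Not at hh
          have g := rat_gap' α (modInv q p) q (by push_cast; exact hh)
          push_cast at g
          have g2 : 1 / (p:ℝ) ≤ 1 / α.den := one_div_le_one_div_of_le hd hw'
          have g3 : α * q + 1/p ≤ (modInv q p:ℝ) := by linarith
          have g4 := mul_le_mul_of_nonneg_right g3 hp0.le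
          have g5 : 1 / (p:ℝ) * p = 1 := by field_simp
          have := mul_lt_mul_of_pos_right h hq0
          nlinarith
        · intro h
          have := mul_le_mul_of_nonneg_right h hp0.le
          by_contra hh
          push Not at hh
          have := mul_le_mul_of_nonneg_right hh hq0.le
          nlinarith
      have e : Nat.Coprime p q ↔ Nat.Coprime q p := Nat.coprime_comm
      simp only [e, this]
    · have hc' : ¬ Nat.Coprime q p := fun h => hc h.symm
      simp [hc, hc']


lemma modInv_coprime (q c : ℕ) (hq : 1 ≤ q) (h : Nat.Coprime q c) : Nat.Coprime q (modInv q c) := by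
  obtain ⟨h1, h2, h3⟩ := modInv_spec q c hq h
  have : Nat.gcd (modInv q c * c) q = Nat.gcd 1 q := h3.gcd_eq
  have h4 : Nat.Coprime (modInv q c * c) q := by rw [Nat.Coprime, this]; simp
  exact (Nat.Coprime.coprime_mul_right h4).symm

lemma modInv_modInv (q c : ℕ) (hc : 1 ≤ c) (hc' : c ≤ q) (h : Nat.Coprime q c) :
    modInv q (modInv q c) = c := by
  obtain ⟨h1, h2, h3⟩ := modInv_spec q c (by omega) h
  exact (modInv_unique q (modInv q c) c (modInv_coprime q c (by omega) h) hc hc'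
    (by rw [mul_comm]; exact h3)).symm

lemma coprime_sub' (q r : ℕ) (h : r ≤ q) : Nat.Coprime q (q - r) ↔ Nat.Coprime q r := by
  rw [Nat.coprime_comm, Nat.coprime_self_sub_left h, Nat.coprime_comm]

lemma wB_count1 (α : ℚ) (h1 : α ≤ 1) (q : ℕ) (hq : 1 ≤ q) :
    ∑ c ∈ Finset.Icc 1 q, wB α q c
      = ∑ r ∈ Finset.range ⌈(α:ℝ) * q⌉₊, if Nat.Coprime q r then (1:ℝ) else 0 := by
  classical
  have hα : (α:ℝ) ≤ 1 := by exact_mod_cast h1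
  have hN : ∀ r, r < ⌈(α:ℝ) * q⌉₊ → r < q := by
    intro r hr
    have := Nat.lt_ceil.mp hr
    have : (r:ℝ) < q := by
      have h0 : (0:ℝ) ≤ q := by positivity
      nlinarith
    exact_mod_cast this
  unfold wB
  rw [Finset.sum_ite, Finset.sum_ite]
  simp only [Finset.sum_const_zero, add_zero, Finset.sum_const, nsmul_eq_mul, mul_one, Nat.cast_inj]
  apply Finset.card_nbij' (fun c => q - modInv q c) (fun r => modInv q (q - r))
  · intro c hc
    simp only [Finset.coe_filter, Finset.mem_Icc, Finset.mem_range, Set.mem_setOf_eq] at hc ⊢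
    obtain ⟨⟨c1, c2⟩, c3, c4⟩ := hc
    obtain ⟨m1, m2, m3⟩ := modInv_spec q c hq c3
    refine ⟨?_, ?_⟩
    · rw [Nat.lt_ceil]; push_cast [m2]; exact c4
    · rw [coprime_sub' _ _ m2]; exact modInv_coprime q c hq c3
  · intro r hr
    simp only [Finset.coe_filter, Finset.mem_Icc, Finset.mem_range, Set.mem_setOf_eq] at hr ⊢
    obtain ⟨r1, r2⟩ := hr
    have r3 := hN r r1
    have r4 : Nat.Coprime q (q - r) := (coprime_sub' _ _ r3.le).mpr r2
    obtain ⟨m1, m2, m3⟩ := modInv_spec q (q - r) hq r4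
    refine ⟨⟨m1, m2⟩, modInv_coprime _ _ hq r4, ?_⟩
    rw [modInv_modInv q (q-r) (by omega) (by omega) r4]
    push_cast [r3.le]
    have := Nat.lt_ceil.mp r1
    linarith
  · intro c hc
    simp only [Finset.coe_filter, Finset.mem_Icc, Finset.mem_range, Set.mem_setOf_eq] at hc ⊢
    obtain ⟨⟨c1, c2⟩, c3, c4⟩ := hc
    obtain ⟨m1, m2, m3⟩ := modInv_spec q c hq c3
    rw [Nat.sub_sub_self m2, modInv_modInv q c c1 c2 c3]
  · intro r hr
    simp only [Finset.coe_filter, Finset.mem_Icc, Finset.mem_range, Set.mem_setOf_eq] at hr ⊢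
    obtain ⟨r1, r2⟩ := hr
    have r3 := hN r r1
    have r4 : Nat.Coprime q (q - r) := (coprime_sub' _ _ r3.le).mpr r2
    rw [modInv_modInv q (q-r) (by omega) (by omega) r4]
    omega

lemma sum_moebius_dvd (n : ℕ) (hn : n ≠ 0) :
    ∑ d ∈ n.divisors, (ArithmeticFunction.moebius d : ℝ) = if n = 1 then 1 else 0 := by
  have h : ∑ d ∈ n.divisors, ArithmeticFunction.moebius d = if n = 1 then 1 else 0 := by
    rw [← ArithmeticFunction.coe_mul_zeta_apply, ArithmeticFunction.moebius_mul_coe_zeta,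
      ArithmeticFunction.one_apply]
  exact_mod_cast h

lemma card_dvd (y : ℝ) (d : ℕ) (hd : 1 ≤ d) :
    ((Finset.range ⌈y * d⌉₊).filter (fun r => d ∣ r)).card = ⌈y⌉₊ := by
  have hd0 : (0:ℝ) < d := by exact_mod_cast hd
  have : (Finset.range ⌈y * d⌉₊).filter (fun r => d ∣ r)
      = (Finset.range ⌈y⌉₊).image (fun j => d * j) := by
    ext r
    simp only [Finset.mem_filter, Finset.mem_range, Finset.mem_image, Nat.lt_ceil]
    constructor
    · rintro ⟨h, j, rfl⟩
      refine ⟨j, ?_, rfl⟩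
      push_cast at h
      rw [mul_comm] at h
      exact lt_of_mul_lt_mul_right h hd0.le
    · rintro ⟨j, hj, rfl⟩
      refine ⟨?_, dvd_mul_right _ _⟩
      push_cast
      rw [mul_comm]
      exact mul_lt_mul_of_pos_right hj hd0
  rw [this, Finset.card_image_of_injective _ (fun a b h => Nat.eq_of_mul_eq_mul_left hd h),
    Finset.card_range]

lemma wB_count (α : ℚ) (h1 : α ≤ 1) (q : ℕ) (hq : 1 ≤ q) :
    ∑ c ∈ Finset.Icc 1 q, wB α q c
      = ∑ d ∈ q.divisors, (ArithmeticFunction.moebius d : ℝ) * (⌈(α:ℝ) * ((q / d : ℕ):ℝ)⌉₊ : ℝ) := by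
  rw [wB_count1 α h1 q hq]
  have e : ∀ r, (if Nat.Coprime q r then (1:ℝ) else 0)
      = ∑ d ∈ q.divisors, if d ∣ r then (ArithmeticFunction.moebius d : ℝ) else 0 := by
    intro r
    have := sum_moebius_dvd (Nat.gcd q r) (Nat.gcd_pos_of_pos_left _ hq).ne'
    rw [← Finset.sum_filter]
    refine this.symm.trans ?_
    apply Finset.sum_congr _ (fun _ _ => rfl)
    ext d
    simp only [Nat.mem_divisors, Finset.mem_filter, Nat.dvd_gcd_iff]
    have := (Nat.gcd_pos_of_pos_left r hq).ne'
    constructor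
    · rintro ⟨⟨a, b⟩, c⟩; exact ⟨⟨a, by omega⟩, b⟩
    · rintro ⟨⟨a, b⟩, c⟩; exact ⟨⟨a, c⟩, this⟩
  simp_rw [e]
  rw [Finset.sum_comm]
  apply Finset.sum_congr rfl
  intro d hd
  have hd' := (Nat.mem_divisors.mp hd).1
  have hd1 : 1 ≤ d := Nat.pos_of_dvd_of_pos hd' hq
  rw [← Finset.sum_filter, Finset.sum_const, nsmul_eq_mul, mul_comm]
  congr 2
  rw [← card_dvd ((α:ℝ) * ((q / d : ℕ):ℝ)) d hd1]
  congr 4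
  rw [mul_assoc]; congr 1
  exact_mod_cast (Nat.div_mul_cancel hd').symm

end

end

section
open Set Filter Topology

noncomputable section

/-- A summable majorant. -/
def lw (d : ℕ) : ℝ := (1 + Real.log d) ^ 2 / (d:ℝ) ^ 2

lemma lw_nonneg (d : ℕ) : 0 ≤ lw d := by unfold lw; positivity

lemma lw_summable : Summable lw := by
  have h : Summable (fun d : ℕ => 25 * (1 / (d:ℝ) ^ (3/2:ℝ))) :=
    (Real.summable_one_div_nat_rpow.mpr (by norm_num)).mul_left _
  refine Summable.of_nonneg_of_le lw_nonneg (fun d => ?_) h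
  unfold lw
  rcases Nat.eq_zero_or_pos d with rfl | hd
  · simp
  have hd1 : (1:ℝ) ≤ d := by exact_mod_cast hd
  have hd0 : (0:ℝ) < d := by linarith
  have h1 : Real.log d ≤ (d:ℝ) ^ (1/4:ℝ) / (1/4) := Real.log_le_rpow_div hd0.le (by norm_num)
  have h2 : (1:ℝ) ≤ (d:ℝ) ^ (1/4:ℝ) := Real.one_le_rpow hd1 (by norm_num)
  have h3 : 0 ≤ Real.log d := Real.log_nonneg hd1
  have h4 : (1 + Real.log d) ^ 2 ≤ 25 * (d:ℝ) ^ (1/2:ℝ) := by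
    have : (d:ℝ) ^ (1/2:ℝ) = ((d:ℝ) ^ (1/4:ℝ)) ^ 2 := by
      rw [← Real.rpow_natCast, ← Real.rpow_mul hd0.le]; norm_num
    rw [this]; nlinarith
  have h5 : (d:ℝ)^2 = (d:ℝ) ^ (3/2:ℝ) * (d:ℝ) ^ (1/2:ℝ) := by
    rw [← Real.rpow_add hd0, ← Real.rpow_natCast]; norm_num
  have h6 : 0 < (d:ℝ) ^ (1/2:ℝ) := by positivity
  have h7 : 0 < (d:ℝ) ^ (3/2:ℝ) := by positivity
  rw [h5, div_le_iff₀ (by positivity)]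
  calc _ ≤ _ := h4
    _ = _ := by field_simp

/-- The inner sum. -/
def psi (α : ℝ) (X : ℝ) : ℝ :=
  ∑ m ∈ Finset.Icc 1 ⌊X⌋₊, (⌈α * m⌉₊ : ℝ) / (m:ℝ)^2 * (Real.log (X / m) - Real.log 2)

lemma sum_to_psi (α : ℝ) (U : ℝ) (hU : 1 ≤ U) :
    ∑ q ∈ Finset.Icc 1 ⌊U⌋₊, (∑ d ∈ q.divisors,
      (ArithmeticFunction.moebius d : ℝ) * (⌈α * ((q / d : ℕ):ℝ)⌉₊ : ℝ)) / (q:ℝ)^2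
        * (Real.log (U / q) - Real.log 2)
    = ∑ d ∈ Finset.Icc 1 ⌊U⌋₊, (ArithmeticFunction.moebius d : ℝ) / (d:ℝ)^2 * psi α (U / d) := by
  unfold psi
  simp_rw [Finset.sum_div, Finset.sum_mul, Finset.mul_sum]
  rw [Finset.sum_sigma', Finset.sum_sigma']
  apply Finset.sum_nbij' (fun x : (_ : ℕ) × ℕ => (⟨x.2, x.1 / x.2⟩ : (_ : ℕ) × ℕ))
    (fun x : (_ : ℕ) × ℕ => (⟨x.1 * x.2, x.1⟩ : (_ : ℕ) × ℕ))
  · rintro ⟨q, d⟩ h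
    simp only [Finset.mem_sigma, Finset.mem_Icc, Nat.mem_divisors] at h ⊢
    obtain ⟨⟨h1, h2⟩, h3, h4⟩ := h
    have hd : 1 ≤ d := Nat.pos_of_dvd_of_pos h3 h1
    have := Nat.le_of_dvd h1 h3
    rw [Nat.floor_div_natCast]
    exact ⟨⟨hd, by omega⟩, Nat.div_pos this hd, Nat.div_le_div_right h2⟩
  · rintro ⟨d, m⟩ h
    simp only [Finset.mem_sigma, Finset.mem_Icc, Nat.mem_divisors] at h ⊢
    rw [Nat.floor_div_natCast] at h
    obtain ⟨⟨h1, h2⟩, h3, h4⟩ := h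
    refine ⟨⟨Nat.mul_pos h1 h3, ?_⟩, dvd_mul_right _ _, (Nat.mul_pos h1 h3).ne'⟩
    rw [mul_comm]
    exact (Nat.le_div_iff_mul_le h1).mp h4
  · rintro ⟨q, d⟩ h
    simp only [Finset.mem_sigma, Finset.mem_Icc, Nat.mem_divisors] at h ⊢
    obtain ⟨⟨h1, h2⟩, h3, h4⟩ := h
    rw [Nat.mul_div_cancel' h3]
  · rintro ⟨d, m⟩ h
    simp only [Finset.mem_sigma, Finset.mem_Icc, Nat.mem_divisors] at h ⊢
    rw [Nat.mul_div_cancel_left _ h.1.1]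
  · rintro ⟨q, d⟩ h
    simp only [Finset.mem_sigma, Finset.mem_Icc, Nat.mem_divisors] at h ⊢
    obtain ⟨⟨h1, h2⟩, h3, h4⟩ := h
    obtain ⟨m, rfl⟩ := h3
    have hd : 1 ≤ d := Nat.pos_of_ne_zero (by rintro rfl; simp at h4)
    rw [Nat.mul_div_cancel_left _ hd]
    push_cast
    rw [div_div]
    ring

lemma logdiff (n : ℕ) (hn : 1 ≤ n) : 1 / ((n:ℝ)+1) ≤ Real.log ((n:ℝ)+1) - Real.log n ∧
    Real.log ((n:ℝ)+1) - Real.log n ≤ 1 / (n:ℝ) := by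
  have h0 : (0:ℝ) < n := by exact_mod_cast hn
  constructor
  · have := Real.one_sub_inv_le_log_of_pos (x := ((n:ℝ)+1)/n) (by positivity)
    rw [Real.log_div (by positivity) (by positivity)] at this
    refine le_trans (le_of_eq ?_) this
    field_simp; ring
  · have := Real.log_le_sub_one_of_pos (x := ((n:ℝ)+1)/n) (by positivity)
    rw [Real.log_div (by positivity) (by positivity)] at this
    refine this.trans (le_of_eq ?_)
    field_simp; ring

lemma Tsum_bound (n : ℕ) (hn : 1 ≤ n) :
    ∑ m ∈ Finset.Icc 1 n, Real.log m / m - Real.log n ^ 2 / 2 ≤ 1 - 1 / n ∧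
    -2 + (Real.log n + 2) / n ≤ ∑ m ∈ Finset.Icc 1 n, Real.log m / m - Real.log n ^ 2 / 2 := by
  induction n, hn using Nat.le_induction with
  | base => simp
  | succ n hn ih =>
    have h0 : (1:ℝ) ≤ n := by exact_mod_cast hn
    rw [Finset.sum_Icc_succ_top (by omega)]
    push_cast
    obtain ⟨d1, d2⟩ := logdiff n hn
    obtain ⟨i1, i2⟩ := ih
    have hl : 0 ≤ Real.log ((n:ℝ)+1) := Real.log_nonneg (by linarith)
    have hl' : Real.log (n:ℝ) = Real.log ((n:ℝ)+1) - (Real.log ((n:ℝ)+1) - Real.log n) := by ring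
    generalize Real.log ((n:ℝ)+1) - Real.log n = δ at *
    rw [hl'] at i1 i2
    generalize Real.log ((n:ℝ)+1) = L at *
    generalize ∑ m ∈ Finset.Icc 1 n, Real.log m / m = T at *
    have e1 : L / ((n:ℝ)+1) = L * (1/((n:ℝ)+1)) := by ring
    have δ0 : 0 ≤ δ := le_trans (by positivity) d1
    have e2 : (L + 2) / ((n:ℝ)+1) = (L+2) * (1/((n:ℝ)+1)) := by ring
    have e3 : (L - δ + 2) / (n:ℝ) = (L - δ+2) * (1/(n:ℝ)) := by ring
    have e4 : 1/(n:ℝ) - 1/((n:ℝ)+1) = (1/n) * (1/((n:ℝ)+1)) := by field_simp; ring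
    have e5 : 1/(n:ℝ) ≤ 2 * (1/((n:ℝ)+1)) := by
      rw [mul_one_div, div_le_div_iff₀ (by positivity) (by positivity)]; linarith
    rw [e1, e2]; rw [e3] at i2
    have s0 : 0 < 1/((n:ℝ)+1) := by positivity
    have t0 : 0 < 1/(n:ℝ) := by positivity
    generalize 1/((n:ℝ)+1) = s at *
    generalize 1/(n:ℝ) = t at *
    constructor
    · nlinarith [mul_nonneg hl (sub_nonneg.mpr d1), mul_nonneg δ0 (sub_nonneg.mpr d2), mul_nonneg t0.le (sub_nonneg.mpr d2), mul_nonneg t0.le (sub_nonneg.mpr e5)]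
    · nlinarith [mul_nonneg hl (sub_nonneg.mpr d2), mul_nonneg δ0 (sub_nonneg.mpr d2), mul_nonneg t0.le (sub_nonneg.mpr d2), mul_nonneg t0.le (sub_nonneg.mpr e5), sq_nonneg δ]

lemma harm_bound (n : ℕ) (hn : 1 ≤ n) :
    Real.eulerMascheroniConstant + Real.log n ≤ ∑ m ∈ Finset.Icc 1 n, 1 / (m:ℝ) ∧
    ∑ m ∈ Finset.Icc 1 n, 1 / (m:ℝ) ≤ Real.eulerMascheroniConstant + Real.log ((n:ℝ)+1) := by
  have e : ∑ m ∈ Finset.Icc 1 n, 1 / (m:ℝ) = (harmonic n : ℝ) := by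
    rw [harmonic_eq_sum_Icc]; push_cast; simp
  rw [e]
  have h1 := Real.eulerMascheroniSeq_lt_eulerMascheroniConstant n
  have h2 := Real.eulerMascheroniConstant_lt_eulerMascheroniSeq' n
  unfold Real.eulerMascheroniSeq at h1
  unfold Real.eulerMascheroniSeq' at h2
  rw [if_neg (by omega)] at h2
  constructor <;> linarith

end

end

section
open Set Filter Topology

noncomputable section

/-- Ceiling defect. -/
def bet (α : ℝ) (m : ℕ) : ℝ := (⌈α * m⌉₊ : ℝ) - α * m

/-- The ceiling-defect constant. -/
def Bc (α : ℝ) : ℝ := ∑' m : ℕ, bet α m / (m:ℝ)^2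

/-- The constant of the majorant. -/
def Kc : ℝ := ∑' d, lw d

lemma Kc_nonneg : 0 ≤ Kc := tsum_nonneg lw_nonneg

lemma bet_nonneg (α : ℝ) (m : ℕ) : 0 ≤ bet α m := by
  unfold bet; linarith [Nat.le_ceil (α * m)]

lemma bet_le (α : ℝ) (hα : 0 ≤ α) (m : ℕ) : bet α m ≤ 1 := by
  unfold bet; linarith [Nat.ceil_lt_add_one (a := α * m) (by positivity)]

lemma bet_summable (α : ℝ) (hα : 0 ≤ α) : Summable (fun m : ℕ => bet α m / (m:ℝ)^2) := by
  refine Summable.of_nonneg_of_le (fun m => div_nonneg (bet_nonneg α m) (by positivity))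
    (fun m => ?_) (Real.summable_one_div_nat_pow.mpr (by norm_num : 1 < 2))
  gcongr
  exact bet_le α hα m

lemma Bc_nonneg (α : ℝ) : 0 ≤ Bc α :=
  tsum_nonneg (fun m => div_nonneg (bet_nonneg α m) (by positivity))

lemma Bc_tail (α : ℝ) (hα : 0 ≤ α) (n : ℕ) (hn : 1 ≤ n) :
    ∑ m ∈ Finset.Icc 1 n, bet α m / (m:ℝ)^2 ≤ Bc α ∧
    Bc α ≤ ∑ m ∈ Finset.Icc 1 n, bet α m / (m:ℝ)^2 + 1 / n := by
  have hs := bet_summable α hα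
  have hn0 : (0:ℝ) < n := by exact_mod_cast hn
  have e : ∑ m ∈ Finset.Icc 1 n, bet α m / (m:ℝ)^2
      = ∑ m ∈ Finset.range (n+1), bet α m / (m:ℝ)^2 := by
    rw [Finset.range_eq_Ico, Finset.sum_eq_sum_Ico_succ_bot (by omega)]
    simp only [Nat.cast_zero, ne_eq, OfNat.ofNat_ne_zero, not_false_eq_true, zero_pow, div_zero, zero_add]
    rfl
  have h := hs.sum_add_tsum_nat_add (n+1)
  rw [e]
  have t0 : 0 ≤ ∑' i : ℕ, bet α (i + (n+1)) / ((i + (n+1) : ℕ):ℝ)^2 :=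
    tsum_nonneg (fun m => div_nonneg (bet_nonneg α _) (by positivity))
  have t1 : ∑' i : ℕ, bet α (i + (n+1)) / ((i + (n+1) : ℕ):ℝ)^2 ≤ 1 / n := by
    have ht := hasSum_tail n hn
    rw [← ht.tsum_eq]
    refine Summable.tsum_le_tsum (fun i => ?_) ((summable_nat_add_iff (f := fun m : ℕ => bet α m / (m:ℝ)^2) (n+1)).mpr hs) ht.summable
    have hi : (0:ℝ) ≤ i := by positivity
    have : 1 / ((n:ℝ) + i) - 1 / ((n:ℝ) + i + 1) = 1 / (((n:ℝ) + i) * ((n:ℝ) + i + 1)) := by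
      field_simp; ring
    rw [this]
    push_cast
    apply div_le_div₀ (by norm_num) (bet_le α hα _) (by positivity)
    nlinarith
  unfold Bc
  constructor <;> linarith

lemma Bc_le (α : ℝ) (hα : 0 ≤ α) : Bc α ≤ 2 := by
  have := (Bc_tail α hα 1 le_rfl).2
  have h := bet_le α hα 1
  simp at this
  linarith

/-- The quadratic main term. -/
def kap (α : ℝ) : ℝ := α * Real.eulerMascheroniConstant + Bc α - α * Real.log 2

lemma gam_bd : 0 ≤ Real.eulerMascheroniConstant ∧ Real.eulerMascheroniConstant ≤ 1 := by
  constructor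
  · linarith [Real.one_half_lt_eulerMascheroniConstant]
  · linarith [Real.eulerMascheroniConstant_lt_two_thirds]

lemma log2_bd : 0 ≤ Real.log 2 ∧ Real.log 2 ≤ 1 := by
  constructor
  · exact Real.log_nonneg (by norm_num)
  · linarith [Real.log_two_lt_d9]

lemma kap_bd (α : ℝ) (h0 : 0 ≤ α) (h1 : α ≤ 1) : |kap α| ≤ 3 := by
  obtain ⟨g1, g2⟩ := gam_bd
  obtain ⟨l1, l2⟩ := log2_bd
  have := Bc_nonneg α
  have := Bc_le α h0
  unfold kap
  rw [abs_le]; constructor <;> nlinarith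

/-- Main term as a function of the logarithm. -/
def Qm (α t : ℝ) : ℝ := α * t^2 / 2 + kap α * t

set_option maxHeartbeats 800000 in
lemma psi_asymp (α : ℝ) (h0 : 0 ≤ α) (h1 : α ≤ 1) (X : ℝ) (hX : 1 ≤ X) :
    |psi α X - Qm α (Real.log X)| ≤ 12 + Kc := by
  set n := ⌊X⌋₊ with hn
  have hn1 : 1 ≤ n := Nat.one_le_floor_iff _ |>.mpr hX
  have hn1' : (1:ℝ) ≤ n := by exact_mod_cast hn1
  have hnX : (n:ℝ) ≤ X := Nat.floor_le (by linarith)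
  have hXn : X < (n:ℝ) + 1 := Nat.lt_floor_add_one X
  set L := Real.log X with hL
  have hL0 : 0 ≤ L := Real.log_nonneg hX
  have hLn : Real.log n ≤ L := Real.log_le_log (by linarith) hnX
  have hLn' : L ≤ Real.log ((n:ℝ)+1) := Real.log_le_log (by linarith) hXn.le
  have hn0 : 0 ≤ Real.log n := Real.log_nonneg hn1'
  obtain ⟨d1, d2⟩ := logdiff n hn1
  have hln : Real.log ((n:ℝ)+1) ≤ n := by
    have := Real.log_le_sub_one_of_pos (x := (n:ℝ)+1) (by positivity); linarith
  have hn2 : L * (1/(n:ℝ)) ≤ 1 := by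
    rw [mul_one_div, div_le_one (by linarith)]; linarith
  have t0 : 0 < 1/(n:ℝ) := by positivity
  have t1 : 1/(n:ℝ) ≤ 1 := by rw [div_le_one (by linarith)]; linarith
  obtain ⟨T1, T2⟩ := Tsum_bound n hn1
  obtain ⟨H1, H2⟩ := harm_bound n hn1
  obtain ⟨B1, B2⟩ := Bc_tail α h0 n hn1
  obtain ⟨g1, g2⟩ := gam_bd
  obtain ⟨l1, l2⟩ := log2_bd
  set T := ∑ m ∈ Finset.Icc 1 n, Real.log m / m with hT
  set H := ∑ m ∈ Finset.Icc 1 n, 1 / (m:ℝ) with hH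
  set b := ∑ m ∈ Finset.Icc 1 n, bet α m / (m:ℝ)^2 with hb
  set c := ∑ m ∈ Finset.Icc 1 n, bet α m / (m:ℝ)^2 * (Real.log m + Real.log 2) with hc
  have ee : psi α X = α * (L * H - T) - α * Real.log 2 * H + (L * b - c) := by
    unfold psi
    rw [hT, hH, hb, hc]
    simp only [Finset.mul_sum, ← Finset.sum_sub_distrib, ← Finset.sum_add_distrib]
    rw [← hn]
    refine Finset.sum_congr rfl (fun m hm => ?_)
    have hm1 : 1 ≤ m := (Finset.mem_Icc.mp hm).1
    have hm0 : (0:ℝ) < m := by exact_mod_cast hm1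
    have : (⌈α * m⌉₊ : ℝ) = α * m + bet α m := by unfold bet; ring
    rw [this, Real.log_div (by positivity) (by positivity), ← hL]
    field_simp
    ring
  have c0 : 0 ≤ c := Finset.sum_nonneg (fun m hm => by
    have hm1 : 1 ≤ m := (Finset.mem_Icc.mp hm).1
    have : 0 ≤ Real.log (m:ℝ) := Real.log_nonneg (by exact_mod_cast hm1)
    have := bet_nonneg α m
    positivity)
  have c1 : c ≤ Kc := by
    refine le_trans (Finset.sum_le_sum (g := lw) (fun m hm => ?_))
      (lw_summable.sum_le_tsum _ (fun i _ => lw_nonneg i))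
    have hm1 : 1 ≤ m := (Finset.mem_Icc.mp hm).1
    have hm0 : (0:ℝ) < m := by exact_mod_cast hm1
    have hl : 0 ≤ Real.log (m:ℝ) := Real.log_nonneg (by exact_mod_cast hm1)
    have := bet_nonneg α m
    have := bet_le α h0 m
    unfold lw
    rw [div_mul_eq_mul_div]
    gcongr
    nlinarith
  have s1 : |L * H - T - (L^2/2 + Real.eulerMascheroniConstant * L)| ≤ 5 := by
    have a1 : |L * (H - L - Real.eulerMascheroniConstant)| ≤ 1 := by
      rw [abs_mul, abs_of_nonneg hL0]
      refine le_trans (mul_le_mul_of_nonneg_left ?_ hL0) hn2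
      rw [abs_le]; constructor <;> linarith
    have a2 : |T - Real.log n ^ 2/2| ≤ 2 := by
      have : 0 ≤ (Real.log n + 2) / n := by positivity
      rw [abs_le]; constructor <;> linarith
    have a3 : |L^2/2 - Real.log n^2/2| ≤ 1 := by
      have : L - Real.log n ≤ 1/n := by linarith
      rw [abs_le]; constructor <;> nlinarith
    have e : L * H - T - (L^2/2 + Real.eulerMascheroniConstant * L)
      = L * (H - L - Real.eulerMascheroniConstant) - (T - Real.log n^2/2) + (L^2/2 - Real.log n^2/2) := by ring
    rw [e]
    rw [abs_le] at *
    constructor <;> linarith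
  have s2 : |H - L| ≤ 2 := by rw [abs_le]; constructor <;> linarith
  have s3 : |L * b - L * Bc α| ≤ 1 := by
    rw [← mul_sub, abs_mul, abs_of_nonneg hL0]
    refine le_trans (mul_le_mul_of_nonneg_left ?_ hL0) hn2
    rw [abs_le]; constructor <;> linarith
  have e : psi α X - Qm α L = α * (L * H - T - (L^2/2 + Real.eulerMascheroniConstant * L))
      - (α * Real.log 2) * (H - L) + (L * b - L * Bc α) - c := by
    rw [ee]; unfold Qm kap; ring
  rw [e]
  have k1 : |α * (L * H - T - (L^2/2 + Real.eulerMascheroniConstant * L))| ≤ 5 := by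
    rw [abs_mul, abs_of_nonneg h0]
    exact (mul_le_mul h1 s1 (abs_nonneg _) zero_le_one).trans (by norm_num)
  have k2 : |(α * Real.log 2) * (H - L)| ≤ 2 := by
    rw [abs_mul, abs_of_nonneg (mul_nonneg h0 l1)]
    have : α * Real.log 2 ≤ 1 := mul_le_one₀ h1 l1 l2
    exact (mul_le_mul this s2 (abs_nonneg _) zero_le_one).trans (by norm_num)
  rw [abs_le] at k1 k2 s3 ⊢
  constructor <;> linarith

/-- Error term at `d`. -/
def Ed (α U : ℝ) (d : ℕ) : ℝ :=
  (if d ∈ Finset.Icc 1 ⌊U⌋₊ then psi α (U / d) else 0) - Qm α (Real.log U - Real.log d)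

lemma Ed_bd (α : ℝ) (h0 : 0 ≤ α) (h1 : α ≤ 1) (U : ℝ) (hU : 1 ≤ U) (d : ℕ) (hd : 1 ≤ d) :
    |Ed α U d| ≤ (12 + Kc) * (1 + Real.log d)^2 := by
  have hd0 : (0:ℝ) < d := by exact_mod_cast hd
  have hl : 0 ≤ Real.log (d:ℝ) := Real.log_nonneg (by exact_mod_cast hd)
  have hK := Kc_nonneg
  unfold Ed
  split_ifs with h
  · have hdU : (d:ℝ) ≤ U := (Nat.le_floor_iff (by linarith)).mp (Finset.mem_Icc.mp h).2
    have := psi_asymp α h0 h1 (U/d) (by rw [le_div_iff₀ hd0]; linarith)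
    rw [Real.log_div (by linarith) (by linarith)] at this
    refine this.trans ?_
    have : 1 ≤ (1 + Real.log d)^2 := by nlinarith
    nlinarith
  · have hdU : U < d := by
      by_contra hh
      push Not at hh
      exact h (Finset.mem_Icc.mpr ⟨hd, (Nat.le_floor_iff (by linarith)).mpr hh⟩)
    have a1 : Real.log U ≤ Real.log d := Real.log_le_log (by linarith) hdU.le
    have a2 : 0 ≤ Real.log U := Real.log_nonneg hU
    have hk := kap_bd α h0 h1
    unfold Qm
    set t := Real.log U - Real.log d with ht
    have t1 : |t| ≤ Real.log d := by rw [abs_le]; constructor <;> linarith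
    have q1 : |α * t^2/2| ≤ (1 + Real.log d)^2 := by
      rw [abs_of_nonneg (by positivity), ← sq_abs t]
      have : |t|^2 ≤ (1 + Real.log d)^2 := by gcongr; linarith
      have := sq_nonneg |t|
      nlinarith
    have q2 : |kap α * t| ≤ 3 * (1 + Real.log d)^2 := by
      rw [abs_mul]
      calc _ ≤ 3 * Real.log d := by gcongr
        _ ≤ _ := by nlinarith
    have : |0 - (α * t^2/2 + kap α * t)| ≤ 4 * (1 + Real.log d)^2 := by
      rw [zero_sub, abs_neg]
      refine (abs_add_le _ _).trans (by linarith)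
    nlinarith [sq_nonneg (1 + Real.log d)]

/-- Möbius moments. -/
def Mom (j : ℕ) : ℝ := ∑' d : ℕ, (ArithmeticFunction.moebius d : ℝ) / (d:ℝ)^2 * Real.log d ^ j

lemma mu_abs (d : ℕ) : |(ArithmeticFunction.moebius d : ℝ)| ≤ 1 := by
  exact_mod_cast ArithmeticFunction.abs_moebius_le_one

lemma Mom_term (j : ℕ) (hj : j ≤ 2) (d : ℕ) :
    ‖(ArithmeticFunction.moebius d : ℝ) / (d:ℝ)^2 * Real.log d ^ j‖ ≤ lw d := by
  rcases Nat.eq_zero_or_pos d with rfl | hd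
  · simp [lw]
  have hl : 0 ≤ Real.log (d:ℝ) := Real.log_nonneg (by exact_mod_cast hd)
  rw [Real.norm_eq_abs, abs_mul, abs_div, abs_of_nonneg (by positivity : (0:ℝ) ≤ (d:ℝ)^2),
    abs_of_nonneg (by positivity : 0 ≤ Real.log (d:ℝ)^j)]
  unfold lw
  rw [div_mul_eq_mul_div]
  gcongr
  calc _ ≤ 1 * Real.log (d:ℝ)^j := by gcongr; exact mu_abs d
    _ ≤ (1 + Real.log d)^j := by rw [one_mul]; gcongr; linarith
    _ ≤ _ := pow_le_pow_right₀ (by linarith) hj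

lemma Mom_summable (j : ℕ) (hj : j ≤ 2) :
    Summable (fun d : ℕ => (ArithmeticFunction.moebius d : ℝ) / (d:ℝ)^2 * Real.log d ^ j) :=
  Summable.of_norm_bounded lw_summable (Mom_term j hj)

lemma Mom_bd (j : ℕ) (hj : j ≤ 2) : |Mom j| ≤ Kc := by
  rw [← Real.norm_eq_abs]
  exact tsum_of_norm_bounded lw_summable.hasSum (Mom_term j hj)

lemma psi_total (α : ℝ) (h0 : 0 ≤ α) (h1 : α ≤ 1) (U : ℝ) (hU : 1 ≤ U) :
    |∑ d ∈ Finset.Icc 1 ⌊U⌋₊, (ArithmeticFunction.moebius d : ℝ) / (d:ℝ)^2 * psi α (U / d)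
      - (Mom 0 * (α * Real.log U^2/2 + kap α * Real.log U) - α * Real.log U * Mom 1)|
    ≤ (16 + Kc) * Kc := by
  set L := Real.log U with hL
  have hE : HasSum (fun d : ℕ => (12 + Kc) * lw d) ((12 + Kc) * Kc) := lw_summable.hasSum.mul_left _
  have hEb : ∀ d : ℕ, ‖(ArithmeticFunction.moebius d : ℝ) / (d:ℝ)^2 * Ed α U d‖ ≤ (12 + Kc) * lw d := by
    intro d
    rcases Nat.eq_zero_or_pos d with rfl | hd
    · simp [lw]
    have := Ed_bd α h0 h1 U hU d hd
    rw [Real.norm_eq_abs, abs_mul, abs_div, abs_of_nonneg (by positivity : (0:ℝ) ≤ (d:ℝ)^2)]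
    unfold lw
    rw [div_mul_eq_mul_div, mul_div_assoc']
    apply div_le_div_of_nonneg_right _ (by positivity)
    calc _ ≤ 1 * |Ed α U d| := by gcongr; exact mu_abs d
      _ ≤ _ := by linarith
  have hEs : Summable (fun d : ℕ => (ArithmeticFunction.moebius d : ℝ) / (d:ℝ)^2 * Ed α U d) :=
    Summable.of_norm_bounded hE.summable hEb
  have hEt : |∑' d : ℕ, (ArithmeticFunction.moebius d : ℝ) / (d:ℝ)^2 * Ed α U d| ≤ (12 + Kc) * Kc := by
    rw [← Real.norm_eq_abs]; exact tsum_of_norm_bounded hE hEb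
  have q0 := (Mom_summable 0 (by norm_num)).hasSum.mul_left (α * L^2/2 + kap α * L)
  have q1 := (Mom_summable 1 (by norm_num)).hasSum.mul_left (-(α * L + kap α))
  have q2 := (Mom_summable 2 (by norm_num)).hasSum.mul_left (α / 2)
  have q := ((q0.add q1).add q2).add hEs.hasSum
  have hf : HasSum (fun d : ℕ => (ArithmeticFunction.moebius d : ℝ) / (d:ℝ)^2 *
      (if d ∈ Finset.Icc 1 ⌊U⌋₊ then psi α (U / d) else 0))
      (∑ d ∈ Finset.Icc 1 ⌊U⌋₊, (ArithmeticFunction.moebius d : ℝ) / (d:ℝ)^2 * psi α (U / d)) := by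
    have := hasSum_sum_of_ne_finset_zero (L := SummationFilter.unconditional ℕ) (f := fun d : ℕ => (ArithmeticFunction.moebius d : ℝ) / (d:ℝ)^2 *
      (if d ∈ Finset.Icc 1 ⌊U⌋₊ then psi α (U / d) else 0)) (s := Finset.Icc 1 ⌊U⌋₊)
      (fun d hd => by simp only [if_neg hd, mul_zero])
    convert this using 1
    exact Finset.sum_congr rfl (fun d hd => by rw [if_pos hd])
  have := hf.tsum_eq.symm.trans (Eq.trans (tsum_congr (fun d => ?_)) q.tsum_eq)
  swap
  · unfold Ed Qm
    rw [← hL]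
    ring
  rw [this]
  change |(α * L^2/2 + kap α * L) * Mom 0 + -(α * L + kap α) * Mom 1 + α / 2 * Mom 2 + _ - _| ≤ _
  have m1 := Mom_bd 1 (by norm_num)
  have m2 := Mom_bd 2 (by norm_num)
  have hk := kap_bd α h0 h1
  have b1 : |kap α * Mom 1| ≤ 3 * Kc := by rw [abs_mul]; gcongr
  have b2 : |α / 2 * Mom 2| ≤ 1 * Kc := by
    rw [abs_mul]; gcongr; rw [abs_le]; constructor <;> linarith
  rw [abs_le] at b1 b2 hEt ⊢
  constructor <;> linarith

end

end

section
open Set Filter Topology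

noncomputable section

lemma Lmu_eq : LSeries (fun n => ((ArithmeticFunction.moebius n : ℤ) : ℂ)) 2 = ((Mom 0 : ℝ) : ℂ) := by
  unfold Mom LSeries
  rw [Complex.ofReal_tsum]
  refine tsum_congr (fun n => ?_)
  rw [LSeries.term_def]
  split_ifs with h
  · subst h; simp
  · push_cast
    simp

lemma Lmulog_eq : LSeries (LSeries.logMul (fun n => ((ArithmeticFunction.moebius n : ℤ) : ℂ))) 2 = ((Mom 1 : ℝ) : ℂ) := by
  unfold Mom LSeries
  rw [Complex.ofReal_tsum]
  refine tsum_congr (fun n => ?_)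
  rw [LSeries.term_def]
  split_ifs with h
  · subst h; simp
  · push_cast
    simp only [LSeries.logMul]
    rw [← Complex.ofReal_natCast, ← Complex.ofReal_log (by positivity)]
    simp
    ring

lemma Mom_zero_eq : Mom 0 = 1 / (Real.pi^2/6) := by
  have h := ArithmeticFunction.LSeries_zeta_mul_Lseries_moebius (s := 2) (by norm_num)
  rw [ArithmeticFunction.LSeries_zeta_eq_riemannZeta (by norm_num), Lmu_eq, riemannZeta_two] at h
  have h' : Real.pi^2/6 * Mom 0 = 1 := by exact_mod_cast h
  have hpi := Real.pi_pos
  field_simp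
  linarith

lemma Mom_one_eq : Mom 1 = zetaDeriv2 / (Real.pi^2/6)^2 := by
  have hM : HasDerivAt (LSeries (fun n => ((ArithmeticFunction.moebius n : ℤ) : ℂ))) (-((Mom 1 : ℝ) : ℂ)) 2 := by
    rw [← Lmulog_eq]
    apply LSeries_hasDerivAt
    rw [ArithmeticFunction.abscissaOfAbsConv_moebius]
    norm_num
    exact_mod_cast (by norm_num : (1:ℝ) < 2)
  have hz : HasDerivAt riemannZeta (deriv riemannZeta 2) 2 :=
    (differentiableAt_riemannZeta (by norm_num)).hasDerivAt
  have hp := hz.mul hM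
  have hev : (riemannZeta * (LSeries (fun n => ((ArithmeticFunction.moebius n : ℤ) : ℂ)))) =ᶠ[𝓝 2] fun _ => (1:ℂ) := by
    have : {s : ℂ | 1 < s.re} ∈ 𝓝 (2:ℂ) :=
      (isOpen_lt continuous_const Complex.continuous_re).mem_nhds (by norm_num)
    filter_upwards [this] with s hs
    rw [Pi.mul_apply, ← ArithmeticFunction.LSeries_zeta_eq_riemannZeta hs]
    exact ArithmeticFunction.LSeries_zeta_mul_Lseries_moebius hs
  have h0 := (hp.congr_of_eventuallyEq hev.symm).unique (hasDerivAt_const (2:ℂ) (1:ℂ))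
  rw [Lmu_eq, riemannZeta_two, Mom_zero_eq] at h0
  have h1 := congrArg Complex.re h0
  have e : (Real.pi:ℂ)^2/6 = ((Real.pi^2/6 : ℝ) : ℂ) := by push_cast; rfl
  rw [e, ← Complex.ofReal_neg, Complex.add_re, Complex.re_mul_ofReal, ← Complex.ofReal_mul, Complex.ofReal_re, Complex.zero_re] at h1
  change zetaDeriv2 * _ + _ = 0 at h1
  have hpi : (0:ℝ) < Real.pi^2/6 := by have := Real.pi_pos; positivity
  generalize Real.pi^2/6 = P at *
  field_simp at h1 ⊢
  linarith

lemma bet_per (α : ℚ) (h0 : 0 < α) (r k : ℕ) : bet α (r + α.den * k) = bet α r := by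
  unfold bet
  have hn : (α.num.toNat : ℤ) = α.num := Int.toNat_of_nonneg (Rat.num_nonneg.mpr h0.le)
  have e : (α:ℝ) * ((r + α.den * k : ℕ):ℝ) = α * r + ((α.num.toNat * k : ℕ):ℝ) := by
    have h1 : (α:ℝ) * α.den = α.num := by exact_mod_cast Rat.mul_den_eq_num α
    have h2 : ((α.num.toNat : ℕ) : ℝ) = (α.num : ℝ) := by exact_mod_cast congrArg (Int.cast (R := ℝ)) hn
    push_cast
    rw [h2, ← h1]; ring
  have hp : (0:ℝ) ≤ α * r := by
    have : (0:ℝ) < α := by exact_mod_cast h0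
    positivity
  rw [e, Nat.ceil_add_natCast hp]
  push_cast; ring

lemma bet_eq (α : ℚ) (h0 : 0 < α) (r : ℕ) (h1 : 1 ≤ r) (h2 : r < α.den) :
    bet α r = 1 - Int.fract ((α:ℝ) * r) := by
  have hp : (0:ℝ) ≤ α * r := by
    have : (0:ℝ) < α := by exact_mod_cast h0
    positivity
  have hf : Int.fract ((α:ℝ) * r) ≠ 0 := by
    intro h
    rw [Int.fract_eq_zero_iff] at h
    obtain ⟨z, hz⟩ := h
    have hz' : (z:ℚ) = α * r := by exact_mod_cast hz
    have h3 : z * α.den = α.num * r := by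
      have : (z:ℚ) * α.den = α.num * r := by
        rw [hz', ← Rat.mul_den_eq_num α]; ring
      exact_mod_cast this
    have h4 : (α.den : ℤ) ∣ α.num * r := ⟨z, by rw [← h3]; ring⟩
    have h5 : α.den ∣ α.num.natAbs * r := by
      have := Int.natAbs_dvd_natAbs.mpr h4
      simpa [Int.natAbs_mul] using this
    have h6 : α.den ∣ r := (α.reduced.symm).dvd_of_dvd_mul_left h5
    have := Nat.le_of_dvd h1 h6
    omega
  unfold bet
  have := Int.ceil_eq_add_one_sub_fract hf
  have hc : ((⌈(α:ℝ) * r⌉₊ : ℕ) : ℝ) = ((⌈(α:ℝ) * r⌉ : ℤ) : ℝ) := by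
    exact natCast_ceil_eq_intCast_ceil hp
  rw [hc, this]; ring

lemma Bc_eq (α : ℚ) (h0 : 0 < α) : Bc α = α * Fcal α := by
  have hα : (0:ℝ) < α := by exact_mod_cast h0
  have hw : 0 < α.den := α.den_pos
  have hw' : (0:ℝ) < α.den := by exact_mod_cast hw
  have : NeZero α.den := ⟨hw.ne'⟩
  unfold Bc
  rw [Nat.sumByResidueClasses (bet_summable α hα.le) α.den]
  have e : ∀ r : ℕ, r < α.den → (∑' m : ℕ, bet α (r + α.den * m) / ((r + α.den * m : ℕ):ℝ)^2)
      = if 1 ≤ r then (1 - Int.fract ((α:ℝ) * r)) * hzeta2 ((r:ℝ)/α.den) / (α.den:ℝ)^2 else 0 := by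
    intro r hr
    split_ifs with h
    · unfold hzeta2
      rw [← tsum_mul_left, ← tsum_div_const]
      refine tsum_congr (fun m => ?_)
      rw [bet_per α h0, bet_eq α h0 r h hr]
      have hr0 : (0:ℝ) < r := by exact_mod_cast h
      push_cast
      field_simp
      ring
    · have : r = 0 := by omega
      subst this
      simp_rw [bet_per α h0]
      simp [bet]
  have e2 : ∑ j : ZMod α.den, (∑' m : ℕ, bet α (j.val + α.den * m) / ((j.val + α.den * m : ℕ):ℝ)^2)
      = ∑ r ∈ Finset.range α.den, (∑' m : ℕ, bet α (r + α.den * m) / ((r + α.den * m : ℕ):ℝ)^2) := by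
    refine Finset.sum_bij (fun j _ => j.val) (fun j _ => Finset.mem_range.mpr (ZMod.val_lt j)) (fun a _ b _ h => ZMod.val_injective _ h) ?_ (fun _ _ => rfl)
    intro b hb
    exact ⟨(b : ZMod α.den), Finset.mem_univ _, ZMod.val_cast_of_lt (Finset.mem_range.mp hb)⟩
  rw [e2, Finset.sum_congr rfl (fun r hr => e r (Finset.mem_range.mp hr)), ← Finset.sum_filter]
  have e3 : (Finset.range α.den).filter (fun r => 1 ≤ r) = Finset.Ico 1 α.den := by
    ext; simp; omega
  rw [e3, ← Finset.sum_div]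
  unfold Fcal
  field_simp

end

end

section
open Set Filter Topology

noncomputable section

lemma inner_count (X : ℝ) (p q k : ℕ) (hq : 1 ≤ q) :
    (∑ n ∈ Finset.Icc 1 ⌊X⌋₊, if k < n ∧ ((n * q + k * p : ℕ):ℝ) ≤ X then (1:ℝ) else 0)
      = (⌊(X - k * ((p:ℝ) + q)) / q⌋₊ : ℝ) := by
  have hq0 : (0:ℝ) < q := by exact_mod_cast hq
  rw [← Finset.sum_filter, Finset.sum_const, nsmul_eq_mul, mul_one, Nat.cast_inj]
  have : (Finset.Icc 1 ⌊X⌋₊).filter (fun n => k < n ∧ ((n * q + k * p : ℕ):ℝ) ≤ X)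
      = (Finset.Icc 1 ⌊(X - k * ((p:ℝ) + q)) / q⌋₊).image (fun m => k + m) := by
    ext n
    simp only [Finset.mem_filter, Finset.mem_Icc, Finset.mem_image]
    constructor
    · rintro ⟨⟨h1, h2⟩, h3, h4⟩
      refine ⟨n - k, ⟨by omega, ?_⟩, by omega⟩
      apply Nat.le_floor
      rw [le_div_iff₀ hq0]
      push_cast [h3.le] at h4 ⊢
      nlinarith
    · rintro ⟨m, ⟨h1, h2⟩, rfl⟩
      have h3 := (Nat.le_floor_iff' (by omega)).mp h2
      rw [le_div_iff₀ hq0] at h3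
      have h4 : (((k + m) * q + k * p : ℕ):ℝ) ≤ X := by push_cast; nlinarith
      refine ⟨⟨by omega, ?_⟩, by omega, h4⟩
      apply Nat.le_floor
      refine le_trans ?_ h4
      exact_mod_cast (le_trans (Nat.le_mul_of_pos_right _ hq) (Nat.le_add_right _ _))
  rw [this, Finset.card_image_of_injective _ (fun a b h => by simpa using h), Nat.card_Icc]
  omega

/-- Number of `(n,k)` for given `p,q`. -/
def Spq (X : ℝ) (p q : ℕ) : ℝ :=
  ∑ k ∈ Finset.Icc 1 ⌊X⌋₊, ∑ n ∈ Finset.Icc 1 ⌊X⌋₊,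
    if k < n ∧ ((n * q + k * p : ℕ):ℝ) ≤ X then (1:ℝ) else 0

lemma sum_id_real (K : ℕ) : ∑ k ∈ Finset.Icc 1 K, (k:ℝ) = K * (K + 1) / 2 := by
  induction K with
  | zero => simp
  | succ K ih => rw [Finset.sum_Icc_succ_top (by omega), ih]; push_cast; ring

lemma Spq_bound (X : ℝ) (p q : ℕ) (hq : 1 ≤ q) (hX : (p:ℝ) + q ≤ X) :
    |Spq X p q - X^2 / (2 * ((q:ℝ) * ((p:ℝ) + q)))| ≤ 2 * X / q := by
  have hq0 : (1:ℝ) ≤ q := by exact_mod_cast hq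
  have hp0 : (0:ℝ) ≤ p := by positivity
  unfold Spq
  simp_rw [inner_count X p _ _ hq]
  set a := (p:ℝ) + q with ha
  have ha1 : 1 ≤ a := by linarith
  set K := ⌊X / a⌋₊ with hK
  have hKX : K ≤ ⌊X⌋₊ := Nat.floor_le_floor (div_le_self (by linarith) ha1)
  have hKx : (K:ℝ) ≤ X / a := Nat.floor_le (by apply div_nonneg <;> linarith)
  have hxK : X / a < K + 1 := Nat.lt_floor_add_one _
  have hsub : ∑ k ∈ Finset.Icc 1 ⌊X⌋₊, (⌊(X - k * a) / q⌋₊ : ℝ)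
      = ∑ k ∈ Finset.Icc 1 K, (⌊(X - k * a) / q⌋₊ : ℝ) := by
    symm
    apply Finset.sum_subset (Finset.Icc_subset_Icc le_rfl hKX)
    intro k hk hk'
    have : K + 1 ≤ k := by
      simp only [Finset.mem_Icc] at hk hk'; omega
    have h1 : ((K:ℝ) + 1) ≤ k := by exact_mod_cast this
    have h2 : X < k * a := by
      rw [div_lt_iff₀ (by linarith)] at hxK
      nlinarith
    rw [Nat.floor_of_nonpos]
    · simp
    · apply div_nonpos_of_nonpos_of_nonneg <;> linarith
  rw [hsub]
  have h1 : |∑ k ∈ Finset.Icc 1 K, (⌊(X - k * a) / q⌋₊ : ℝ) - ∑ k ∈ Finset.Icc 1 K, (X - k * a) / q| ≤ K := by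
    rw [← Finset.sum_sub_distrib]
    refine (Finset.abs_sum_le_sum_abs _ _).trans ?_
    have : ∀ k ∈ Finset.Icc 1 K, |(⌊(X - k * a) / q⌋₊ : ℝ) - (X - k * a) / q| ≤ 1 := by
      intro k hk
      have hkK : (k:ℝ) ≤ K := by exact_mod_cast (Finset.mem_Icc.mp hk).2
      have : (k:ℝ) * a ≤ X := by
        rw [← le_div_iff₀ (by linarith)]; linarith
      have g1 := Nat.floor_le (a := (X - k * a) / q) (by apply div_nonneg <;> linarith)
      have g2 := Nat.lt_floor_add_one ((X - k * a) / q)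
      rw [abs_le]; constructor <;> linarith
    refine (Finset.sum_le_sum this).trans ?_
    simp
  have h2 : ∑ k ∈ Finset.Icc 1 K, (X - k * a) / q = (K * X - a * (K * (K+1)/2)) / q := by
    rw [← Finset.sum_div, Finset.sum_sub_distrib, ← Finset.sum_mul, sum_id_real]
    simp; ring
  rw [h2] at h1
  have hx1 : 1 ≤ X / a := by rw [le_div_iff₀ (by linarith)]; linarith
  set x := X / a with hx
  have hXa : X = x * a := by rw [hx]; field_simp
  have h3 : |(K * X - a * (K * (K+1)/2)) / q - X^2 / (2 * ((q:ℝ) * a))| ≤ X / q := by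
    have : (K * X - a * (K * (K+1)/2)) / q - X^2 / (2 * ((q:ℝ) * a))
        = -(a / q * ((x - K)^2/2 + K/2)) := by
      rw [hXa]; field_simp; ring
    rw [this, abs_neg, abs_of_nonneg (by positivity), hXa]
    have hh : (x - K)^2/2 + K/2 ≤ x := by nlinarith
    calc _ ≤ a / q * x := by gcongr
      _ = _ := by ring
  have h4 : (K:ℝ) ≤ X / q := by
    refine hKx.trans ?_
    rw [hx]
    apply div_le_div_of_nonneg_left (by linarith) (by linarith) (by linarith)
  have h5 : 2 * X / q = X / q + X / q := by ring
  rw [abs_le] at *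
  constructor <;> linarith

lemma count_eq (α : ℚ) (U : ℝ) (hU : 2 ≤ U) :
    ({x : ℕ × ℕ × ℕ × ℕ | Case3 α U x.1 x.2.1 x.2.2.1 x.2.2.2}.ncard : ℝ)
      = ∑ p ∈ Finset.Icc 1 ⌊U⌋₊, ∑ q ∈ Finset.Ico 1 p, wA α p q * Spq (U^2) p q := by
  classical
  set N := ⌊U⌋₊
  set M := ⌊U^2⌋₊
  have hset : {x : ℕ × ℕ × ℕ × ℕ | Case3 α U x.1 x.2.1 x.2.2.1 x.2.2.2}
      = ((Finset.Icc 1 N ×ˢ Finset.Icc 1 N ×ˢ Finset.Icc 1 M ×ˢ Finset.Icc 1 M).filter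
          (fun x => Case3 α U x.1 x.2.1 x.2.2.1 x.2.2.2) : Finset (ℕ × ℕ × ℕ × ℕ)) := by
    ext ⟨p, q, n, k⟩
    simp only [Finset.coe_filter, Finset.mem_product, Finset.mem_Icc, Set.mem_ofPred_eq]
    constructor
    · intro h
      refine ⟨?_, h⟩
      obtain ⟨h1, h2, h3, h4, h5, h6, h7, h8, h9⟩ := h
      have hp : p ≤ N := Nat.le_floor h4
      have hm : n * q + k * p ≤ M := Nat.le_floor h6
      have a1 : n ≤ n * q := Nat.le_mul_of_pos_right _ h2
      refine ⟨⟨by omega, hp⟩, ⟨h2, by omega⟩, ⟨by omega, by omega⟩, h7, by omega⟩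
    · exact fun h => h.2
  rw [hset, Set.ncard_coe_finset, Finset.card_filter]
  push_cast
  rw [Finset.sum_product]
  refine Finset.sum_congr rfl (fun p hp => ?_)
  obtain ⟨hp1, hp2⟩ := Finset.mem_Icc.mp hp
  have hpU : (p:ℝ) ≤ U := (Nat.le_floor_iff (by linarith)).mp hp2
  rw [Finset.sum_product]
  have hsub : Finset.Ico 1 p ⊆ Finset.Icc 1 N := by
    intro q hq
    rw [Finset.mem_Ico] at hq
    rw [Finset.mem_Icc]; omega
  rw [← Finset.sum_subset hsub]
  · refine Finset.sum_congr rfl (fun q hq => ?_)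
    obtain ⟨hq1, hq2⟩ := Finset.mem_Ico.mp hq
    rw [Finset.sum_product_right]
    unfold Spq
    rw [Finset.mul_sum]
    refine Finset.sum_congr rfl (fun k hk => ?_)
    rw [Finset.mul_sum]
    refine Finset.sum_congr rfl (fun n hn => ?_)
    have hk1 := (Finset.mem_Icc.mp hk).1
    have hn1 := (Finset.mem_Icc.mp hn).1
    have h2 : 2 ≤ n * q + k * p := by
      have := Nat.mul_pos hn1 hq1
      have := Nat.mul_pos hk1 hp1
      omega
    have hiff : Case3 α U p q n k ↔ (Nat.Coprime p q ∧ (modInv p q : ℝ) ≤ (α:ℝ) * p) ∧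
        (k < n ∧ ((n * q + k * p : ℕ):ℝ) ≤ U^2) := by
      unfold Case3
      constructor
      · rintro ⟨a1, a2, a3, a4, a5, a6, a7, a8, a9⟩
        exact ⟨⟨a1, a9⟩, a8, a6⟩
      · rintro ⟨⟨a1, a9⟩, a8, a6⟩
        exact ⟨a1, hq1, hq2, hpU, h2, a6, hk1, a8, a9⟩
    unfold wA
    by_cases c1 : Nat.Coprime p q ∧ (modInv p q : ℝ) ≤ (α:ℝ) * p
    · by_cases c2 : k < n ∧ ((n * q + k * p : ℕ):ℝ) ≤ U^2
      · rw [if_pos (hiff.mpr ⟨c1, c2⟩), if_pos c1, if_pos c2, mul_one]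
      · rw [if_neg (fun h => c2 (hiff.mp h).2), if_neg c2, mul_zero]
    · rw [if_neg (fun h => c1 (hiff.mp h).1), if_neg c1, zero_mul]
  · intro q hq hq'
    apply Finset.sum_eq_zero
    rintro ⟨n, k⟩ _
    rw [if_neg]
    rintro ⟨a1, a2, a3, -⟩
    exact hq' (Finset.mem_Ico.mpr ⟨a2, a3⟩)

lemma count_approx (α : ℚ) (U : ℝ) (hU : 2 ≤ U) :
    |({x : ℕ × ℕ × ℕ × ℕ | Case3 α U x.1 x.2.1 x.2.2.1 x.2.2.2}.ncard : ℝ) / U^4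
      - (∑ p ∈ Finset.Icc 1 ⌊U⌋₊, ∑ q ∈ Finset.Ico 1 p, wA α p q * (1/((q:ℝ)*((p:ℝ)+q)))) / 2| ≤ 2 := by
  rw [count_eq α U hU]
  have hN1 : 1 ≤ ⌊U⌋₊ := (Nat.one_le_floor_iff _).mpr (by linarith)
  have hN1' : (1:ℝ) ≤ ⌊U⌋₊ := by exact_mod_cast hN1
  have hNU : (⌊U⌋₊:ℝ) ≤ U := Nat.floor_le (by linarith)
  have hU0 : 0 < U := by linarith
  simp_rw [Finset.sum_div]
  rw [← Finset.sum_sub_distrib]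
  simp_rw [← Finset.sum_sub_distrib]
  have key : ∀ p ∈ Finset.Icc 1 ⌊U⌋₊, |∑ q ∈ Finset.Ico 1 p, (wA α p q * Spq (U^2) p q / U^4
      - wA α p q * (1/((q:ℝ)*((p:ℝ)+q))) / 2)| ≤ 2 / U^2 * (1 + Real.log ⌊U⌋₊) := by
    intro p hp
    obtain ⟨hp1, hp2⟩ := Finset.mem_Icc.mp hp
    have hpU : (p:ℝ) ≤ U := (Nat.le_floor_iff (by linarith)).mp hp2
    refine (Finset.abs_sum_le_sum_abs _ _).trans ?_
    have hq : ∀ q ∈ Finset.Ico 1 p, |wA α p q * Spq (U^2) p q / U^4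
      - wA α p q * (1/((q:ℝ)*((p:ℝ)+q))) / 2| ≤ 2 / U^2 * (1/(q:ℝ)) := by
      intro q hq
      obtain ⟨hq1, hq2⟩ := Finset.mem_Ico.mp hq
      have hq0 : (0:ℝ) < q := by exact_mod_cast hq1
      have hqp : (q:ℝ) ≤ p := by exact_mod_cast hq2.le
      have hb := Spq_bound (U^2) p q hq1 (by nlinarith)
      have e : wA α p q * Spq (U^2) p q / U^4 - wA α p q * (1/((q:ℝ)*((p:ℝ)+q))) / 2
        = wA α p q * ((Spq (U^2) p q - (U^2)^2 / (2 * ((q:ℝ) * ((p:ℝ) + q)))) / U^4) := by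
        field_simp
      rw [e, abs_mul, abs_of_nonneg ((swapAB α).a0 p q), abs_div, abs_of_nonneg (by positivity : (0:ℝ) ≤ U^4)]
      calc _ ≤ 1 * ((2 * U^2/q) / U^4) := by
            apply mul_le_mul ((swapAB α).a1 p q) _ (by positivity) zero_le_one
            gcongr
        _ = _ := by field_simp
    refine (Finset.sum_le_sum hq).trans ?_
    rw [← Finset.mul_sum]
    gcongr
    refine le_trans (Finset.sum_le_sum_of_subset_of_nonneg ?_ (fun i _ _ => by positivity)) (harm_le _ hN1)
    intro q hq
    rw [Finset.mem_Ico] at hq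
    rw [Finset.mem_Icc]; omega
  refine (Finset.abs_sum_le_sum_abs _ _).trans ((Finset.sum_le_sum key).trans ?_)
  rw [Finset.sum_const, Nat.card_Icc, nsmul_eq_mul]
  simp only [Nat.add_sub_cancel]
  have hl : Real.log ⌊U⌋₊ ≤ U - 1 := by
    have := Real.log_le_sub_one_of_pos (x := (⌊U⌋₊:ℝ)) (by linarith); linarith
  have hl0 : 0 ≤ Real.log ⌊U⌋₊ := Real.log_nonneg hN1'
  calc (⌊U⌋₊:ℝ) * (2 / U^2 * (1 + Real.log ⌊U⌋₊)) ≤ U * (2 / U^2 * U) := by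
        apply mul_le_mul hNU _ (by positivity) (by linarith)
        apply mul_le_mul_of_nonneg_left (by linarith) (by positivity)
    _ = 2 := by field_simp

lemma final_bound (α : ℚ) (h0 : 0 < α) (h1 : α ≤ 1) (U : ℝ) (hU : 2 ≤ U) :
    |(({x : ℕ × ℕ × ℕ × ℕ | Case3 α U x.1 x.2.1 x.2.2.1 x.2.2.2}.ncard : ℝ)) / U^4
        - (α : ℝ) * (Real.log U)^2 / (4 * (Real.pi^2/6))
        - (α : ℝ) * Real.log U / (2 * (Real.pi^2/6)) *
            (Real.eulerMascheroniConstant - zetaDeriv2 / (Real.pi^2/6)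
              + Fcal α - Real.log 2)|
      ≤ (28 + (16 + Kc) * Kc) * (1 + Real.log α.den)^2 := by
  have hα0 : (0:ℝ) ≤ α := by exact_mod_cast h0.le
  have hα1 : (α:ℝ) ≤ 1 := by exact_mod_cast h1
  have r1 := count_approx α U hU
  have r2 := swap_main α.den_pos (swapAB α) (swapBA α) U (by linarith)
  have e : ∑ q∈Finset.Icc 1 ⌊U⌋₊, (∑ c∈Finset.Icc 1 q, wB α q c)/(q:ℝ)^2 * (Real.log (U/q) - Real.log 2)
      = ∑ d ∈ Finset.Icc 1 ⌊U⌋₊, (ArithmeticFunction.moebius d : ℝ) / (d:ℝ)^2 * psi α (U / d) := by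
    rw [← sum_to_psi α U (by linarith)]
    refine Finset.sum_congr rfl (fun q hq => ?_)
    rw [wB_count α h1 q (Finset.mem_Icc.mp hq).1]
  rw [e] at r2
  have r3 := psi_total α hα0 hα1 U (by linarith)
  have hw : 1 ≤ (1 + Real.log α.den)^2 := by
    have : 0 ≤ Real.log (α.den:ℝ) := Real.log_nonneg (by exact_mod_cast α.den_pos)
    nlinarith
  have hK : 0 ≤ (16 + Kc) * Kc := by have := Kc_nonneg; positivity
  have hKw := mul_le_mul_of_nonneg_left hw hK
  have e2 : (α : ℝ) * (Real.log U)^2 / (4 * (Real.pi^2/6))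
        + (α : ℝ) * Real.log U / (2 * (Real.pi^2/6)) *
            (Real.eulerMascheroniConstant - zetaDeriv2 / (Real.pi^2/6)
              + Fcal α - Real.log 2)
      = (Mom 0 * (α * Real.log U^2/2 + kap α * Real.log U) - α * Real.log U * Mom 1) / 2 := by
    rw [Mom_zero_eq, Mom_one_eq, kap, Bc_eq α h0]
    have hpi : (0:ℝ) < Real.pi^2/6 := by have := Real.pi_pos; positivity
    generalize Real.pi^2/6 = P at *
    field_simp
    ring
  rw [sub_sub, e2]
  rw [abs_le] at *
  constructor <;> linarith

end


end

/-- **Proposition 3.1 (3).** `R_{3,α}(U)/U⁴ = α(log U)²/(4ζ(2))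
+ (α log U/(2ζ(2)))(γ - ζ'(2)/ζ(2) + F(α) - log 2) + O((1 + log w)²)`,
with an absolute implied constant. -/
theorem case3_count :
    ∃ C : ℝ, 0 < C ∧ ∀ α : ℚ, 0 < α → α ≤ 1 → ∀ U : ℝ, 2 ≤ U →
      |(({x : ℕ × ℕ × ℕ × ℕ | Case3 α U x.1 x.2.1 x.2.2.1 x.2.2.2}.ncard : ℝ)) / U^4
        - (α : ℝ) * (Real.log U)^2 / (4 * (Real.pi^2/6))
        - (α : ℝ) * Real.log U / (2 * (Real.pi^2/6)) *
            (Real.eulerMascheroniConstant - zetaDeriv2 / (Real.pi^2/6)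
              + Fcal α - Real.log 2)|
      ≤ C * (1 + Real.log α.den)^2 := by
  refine ⟨28 + (16 + Kc) * Kc, ?_, final_bound⟩
  have := Kc_nonneg
  positivity
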